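/- Let Λ be a finite dimensional algebra over a field K and let (T,F) be a functorially finite torsion pair in mod Λ. Then (T,F) is a Gorenstein torsion pair in mod Λ if and only if (DF, DT) is a Gorenstein torsion pair in mod Λ^op, where DF = {DF : F ∈ F} and DT = {DT : T ∈ T}. -/

import Mathlib

/-!  Common definitions: Gorenstein projective/injective modules, transpose,
Auslander–Reiten translation, τ-rigid and τ-tilting modules and pairs,
torsion pairs, etc., over a finite dimensional algebra.
Throughout, "mod Λ" is modelled by the category of finitely generated
(left) modules over a finite dimensional `K`-algebra `R`, and
"mod Λᵒᵖ" by finitely generated `Rᵐᵒᵖ`-modules. -/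

universe u

open Function MulOpposite

namespace GPTau

section Ring

variable (R : Type u) [Ring R]

/-- A submodule `N ≤ M` is superfluous (small) if `N ⊔ N' = ⊤` implies `N' = ⊤`. -/
def IsSuperfluous {M : Type u} [AddCommGroup M] [Module R M] (N : Submodule R M) : Prop :=
  ∀ N' : Submodule R M, N ⊔ N' = ⊤ → N' = ⊤

/-- `M` is Gorenstein projective: there is a doubly infinite exact sequence of
finitely generated projective modules which stays exact under `Hom(-, R)` and
such that `M ≅ Im (P₋₁ → P₀)`. -/
def IsGP (M : Type u) [AddCommGroup M] [Module R M] : Prop :=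
  ∃ (P : ℤ → Type u) (_ : ∀ n, AddCommGroup (P n)) (_ : ∀ n, Module R (P n))
    (d : ∀ n : ℤ, P n →ₗ[R] P (n + 1)),
    (∀ n, Module.Finite R (P n)) ∧
    (∀ n, Module.Projective R (P n)) ∧
    (∀ n, Function.Exact (d n) (d (n + 1))) ∧
    (∀ n, Function.Exact
      (fun g : P (n + 1 + 1) →ₗ[R] R => g.comp (d (n + 1)))
      (fun g : P (n + 1) →ₗ[R] R => g.comp (d n))) ∧
    Nonempty (M ≃ₗ[R] LinearMap.range (d (-1)))

/-- A linear map factors through a (finitely generated) projective module. -/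
def FactorsThroughProj {A B : Type u} [AddCommGroup A] [Module R A]
    [AddCommGroup B] [Module R B] (f : A →ₗ[R] B) : Prop :=
  ∃ (Q : Type u) (_ : AddCommGroup Q) (_ : Module R Q),
    Module.Projective R Q ∧ ∃ (a : A →ₗ[R] Q) (b : Q →ₗ[R] B), b.comp a = f

/-- Two maps are equal in the stable category (mod projectives). -/
def StEq {A B : Type u} [AddCommGroup A] [Module R A] [AddCommGroup B] [Module R B]
    (f g : A →ₗ[R] B) : Prop :=
  FactorsThroughProj R (f - g)

/-- An indecomposable module. -/
def IsIndec (M : Type u) [AddCommGroup M] [Module R M] : Prop :=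
  Nontrivial M ∧ ∀ N₁ N₂ : Submodule R M, IsCompl N₁ N₂ → N₁ = ⊥ ∨ N₂ = ⊥

/-- `|M| = k` : `M` decomposes into indecomposable direct summands having
exactly `k` isomorphism classes. -/
def NumIndec (M : Type u) [AddCommGroup M] [Module R M] (k : ℕ) : Prop :=
  ∃ (n : ℕ) (N : Fin n → Submodule R M),
    DirectSum.IsInternal N ∧ (∀ i, IsIndec R (N i)) ∧
    ∃ c : Fin n → Fin k, Surjective c ∧
      ∀ i j, (c i = c j ↔ Nonempty ((N i) ≃ₗ[R] (N j)))

/-- A basic module: it is a direct sum of pairwise nonisomorphic indecomposables. -/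
def IsBasic (M : Type u) [AddCommGroup M] [Module R M] : Prop :=
  ∃ (n : ℕ) (N : Fin n → Submodule R M),
    DirectSum.IsInternal N ∧ (∀ i, IsIndec R (N i)) ∧
    ∀ i j, i ≠ j → ¬ Nonempty ((N i) ≃ₗ[R] (N j))

/-- `M` has no nonzero projective direct summand. -/
def NoProjSummand (M : Type u) [AddCommGroup M] [Module R M] : Prop :=
  ∀ N₁ N₂ : Submodule R M, IsCompl N₁ N₂ → Module.Projective R N₁ → N₁ = ⊥

/-- `X` is a direct summand of `T`. -/
def IsDirectSummand (X T : Type u) [AddCommGroup X] [Module R X]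
    [AddCommGroup T] [Module R T] : Prop :=
  ∃ (i : X →ₗ[R] T) (p : T →ₗ[R] X), p.comp i = LinearMap.id

/-- `Ext¹(X, Y) = 0`: every short exact sequence `0 → Y → E → X → 0` splits. -/
def Ext1Vanishes (X Y : Type u) [AddCommGroup X] [Module R X]
    [AddCommGroup Y] [Module R Y] : Prop :=
  ∀ (E : Type u) [AddCommGroup E] [Module R E] (i : Y →ₗ[R] E) (p : E →ₗ[R] X),
    Injective i → Surjective p → Function.Exact i p →
    ∃ s : X →ₗ[R] E, p.comp s = LinearMap.id

/-- `X ∈ Fac G`: `X` is a quotient of a finite direct sum of copies of `G`. -/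
def FacOf (G X : Type u) [AddCommGroup G] [Module R G] [AddCommGroup X] [Module R X] : Prop :=
  ∃ (n : ℕ) (p : (Fin n → G) →ₗ[R] X), Surjective p

/-- `X ∈ Sub C`: `X` embeds into a finite direct sum of copies of `C`. -/
def SubOf (C X : Type u) [AddCommGroup C] [Module R C] [AddCommGroup X] [Module R X] : Prop :=
  ∃ (n : ℕ) (i : X →ₗ[R] (Fin n → C)), Injective i

/-- `X ∈ add G`: `X` is a direct summand of a finite direct sum of copies of `G`. -/
def InAdd (G X : Type u) [AddCommGroup G] [Module R G] [AddCommGroup X] [Module R X] : Prop :=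
  ∃ (n : ℕ) (i : X →ₗ[R] (Fin n → G)) (p : (Fin n → G) →ₗ[R] X), p.comp i = LinearMap.id

/-- The Jacobson radical of `R` (as a left ideal). -/
def JacobsonRad : Ideal R := (⊥ : Ideal R).jacobson

/-- The Jacobson radical squares to zero. -/
def RadSquareZero : Prop :=
  ∀ x y : R, x ∈ JacobsonRad R → y ∈ JacobsonRad R → x * y = 0

/-- A uniserial module: its submodules form a chain. -/
def IsUniserial (M : Type u) [AddCommGroup M] [Module R M] : Prop :=
  ∀ N₁ N₂ : Submodule R M, N₁ ≤ N₂ ∨ N₂ ≤ N₁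

/-- `R` has finite global dimension: there is `n` such that every finitely
generated module has a projective resolution vanishing in degrees `> n`. -/
def FiniteGlobalDimension : Prop :=
  ∃ n : ℕ, ∀ (M : Type u) [AddCommGroup M] [Module R M], Module.Finite R M →
    ∃ (P : ℕ → Type u) (_ : ∀ i, AddCommGroup (P i)) (_ : ∀ i, Module R (P i))
      (d : ∀ i : ℕ, P (i + 1) →ₗ[R] P i) (ε : P 0 →ₗ[R] M),
      (∀ i, Module.Projective R (P i)) ∧ Surjective ε ∧
      Function.Exact (d 0) ε ∧ (∀ i, Function.Exact (d (i + 1)) (d i)) ∧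
      (∀ i, n < i → Subsingleton (P i))

/-- The injective dimension of `R` as a module over itself is at most 1. -/
def SelfInjDimLE1 : Prop :=
  ∃ (I₀ I₁ : Type u) (_ : AddCommGroup I₀) (_ : Module R I₀)
    (_ : AddCommGroup I₁) (_ : Module R I₁),
    Module.Finite R I₀ ∧ Module.Finite R I₁ ∧
    Module.Injective R I₀ ∧ Module.Injective R I₁ ∧
    ∃ (i : R →ₗ[R] I₀) (p : I₀ →ₗ[R] I₁),
      Injective i ∧ Surjective p ∧ Function.Exact i p

end Ring

section Algebra

variable (R : Type u) [Ring R] (K : Type u) [Field K] [Algebra K R]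

/-- For an algebra over a field, the scalars of the base field commute with the
ring action on any compatible module. -/
instance (priority := 100) smulCommClass_of_tower (M : Type u) [AddCommGroup M]
    [Module R M] [Module K M] [IsScalarTower K R M] : SMulCommClass R K M :=
  ⟨fun r k m => by
    rw [← algebraMap_smul R k m, ← mul_smul, ← Algebra.commutes, mul_smul, algebraMap_smul]⟩

end Algebra

section OpDual

variable (R : Type u) [Ring R] (K : Type u) [Field K] [Algebra K R]
variable (M : Type u) [AddCommGroup M] [Module Rᵐᵒᵖ M] [Module K M]
  [IsScalarTower K Rᵐᵒᵖ M]

/-- The `K`-dual of a (finitely generated) `Rᵐᵒᵖ`-module, as an `R`-module: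
this is the duality `D : mod Λᵒᵖ → mod Λ`. -/
def OpDual (R : Type u) [Ring R] (K : Type u) [Field K] [Algebra K R]
    (M : Type u) [AddCommGroup M] [Module Rᵐᵒᵖ M] [Module K M]
    [IsScalarTower K Rᵐᵒᵖ M] : Type u := M →ₗ[K] K

instance : AddCommGroup (OpDual R K M) := inferInstanceAs (AddCommGroup (M →ₗ[K] K))

instance : Module K (OpDual R K M) := inferInstanceAs (Module K (M →ₗ[K] K))

/-- Scalar action `x ↦ op r • x` as a `K`-linear map. -/
def opSmulHom (r : R) : M →ₗ[K] M where
  toFun x := op r • x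
  map_add' x y := smul_add _ x y
  map_smul' k x := smul_comm (op r) k x

/-- Reinterpret an element of the dual as a linear functional. -/
def OpDual.toL (f : OpDual R K M) : M →ₗ[K] K := f

lemma OpDual.toL_injective :
    Function.Injective (OpDual.toL R K M) := fun _ _ h => h

instance : SMul R (OpDual R K M) :=
  ⟨fun r f => ((OpDual.toL R K M f).comp (opSmulHom R K M r) : M →ₗ[K] K)⟩

lemma OpDual.smul_toL (r : R) (f : OpDual R K M) (x : M) :
    OpDual.toL R K M (r • f) x = OpDual.toL R K M f (op r • x) := rfl

lemma OpDual.toL_add (f g : OpDual R K M) :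
    OpDual.toL R K M (f + g) = OpDual.toL R K M f + OpDual.toL R K M g := rfl

lemma OpDual.toL_zero : OpDual.toL R K M 0 = 0 := rfl

instance : Module R (OpDual R K M) where
  one_smul f := OpDual.toL_injective R K M <| LinearMap.ext fun x => by
    rw [OpDual.smul_toL, op_one, one_smul]
  mul_smul r s f := OpDual.toL_injective R K M <| LinearMap.ext fun x => by
    rw [OpDual.smul_toL, OpDual.smul_toL, OpDual.smul_toL, op_mul, mul_smul]
  smul_zero r := OpDual.toL_injective R K M <| LinearMap.ext fun x => by
    rw [OpDual.smul_toL, OpDual.toL_zero]; simp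
  smul_add r f g := OpDual.toL_injective R K M <| LinearMap.ext fun x => by
    rw [OpDual.smul_toL, OpDual.toL_add]
    simp only [LinearMap.add_apply, OpDual.toL_add]
    rw [OpDual.smul_toL, OpDual.smul_toL]
  add_smul r s f := OpDual.toL_injective R K M <| LinearMap.ext fun x => by
    rw [OpDual.smul_toL]
    simp only [OpDual.toL_add, LinearMap.add_apply]
    rw [OpDual.smul_toL, OpDual.smul_toL, op_add, add_smul, map_add]
  zero_smul f := OpDual.toL_injective R K M <| LinearMap.ext fun x => by
    rw [OpDual.smul_toL, OpDual.toL_zero, op_zero, zero_smul, map_zero]; rfl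

instance : IsScalarTower K R (OpDual R K M) :=
  ⟨fun k r f => OpDual.toL_injective R K M <| LinearMap.ext fun x => by
    have h1 : OpDual.toL R K M ((k • r) • f) x = OpDual.toL R K M f (op (k • r) • x) := rfl
    have h2 : OpDual.toL R K M (k • (r • f)) x = k • OpDual.toL R K M f (op r • x) := rfl
    rw [h1, h2, op_smul, smul_assoc, map_smul]⟩

end OpDual

section LDual

variable (R : Type u) [Ring R] (K : Type u) [Field K] [Algebra K R]
variable (M : Type u) [AddCommGroup M] [Module R M] [Module K M]
  [IsScalarTower K R M]

/-- The `K`-dual of a (finitely generated) `R`-module, as an `Rᵐᵒᵖ`-module: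
this is the duality `D : mod Λ → mod Λᵒᵖ`. -/
def LDual (R : Type u) [Ring R] (K : Type u) [Field K] [Algebra K R]
    (M : Type u) [AddCommGroup M] [Module R M] [Module K M]
    [IsScalarTower K R M] : Type u := M →ₗ[K] K

instance : AddCommGroup (LDual R K M) := inferInstanceAs (AddCommGroup (M →ₗ[K] K))

instance : Module K (LDual R K M) := inferInstanceAs (Module K (M →ₗ[K] K))

/-- Scalar action `x ↦ r • x` as a `K`-linear map. -/
def lSmulHom (r : R) : M →ₗ[K] M where
  toFun x := r • x
  map_add' x y := smul_add _ x y
  map_smul' k x := smul_comm r k x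

/-- Reinterpret an element of the dual as a linear functional. -/
def LDual.toL (f : LDual R K M) : M →ₗ[K] K := f

lemma LDual.toL_injective : Function.Injective (LDual.toL R K M) := fun _ _ h => h

instance : SMul Rᵐᵒᵖ (LDual R K M) :=
  ⟨fun s f => ((LDual.toL R K M f).comp (lSmulHom R K M (unop s)) : M →ₗ[K] K)⟩

lemma LDual.smul_toL (s : Rᵐᵒᵖ) (f : LDual R K M) (x : M) :
    LDual.toL R K M (s • f) x = LDual.toL R K M f (unop s • x) := rfl

lemma LDual.toL_add (f g : LDual R K M) :
    LDual.toL R K M (f + g) = LDual.toL R K M f + LDual.toL R K M g := rfl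

lemma LDual.toL_zero : LDual.toL R K M 0 = 0 := rfl

instance : Module Rᵐᵒᵖ (LDual R K M) where
  one_smul f := LDual.toL_injective R K M <| LinearMap.ext fun x => by
    rw [LDual.smul_toL, unop_one, one_smul]
  mul_smul s t f := LDual.toL_injective R K M <| LinearMap.ext fun x => by
    rw [LDual.smul_toL, LDual.smul_toL, LDual.smul_toL, unop_mul, mul_smul]
  smul_zero s := LDual.toL_injective R K M <| LinearMap.ext fun x => by
    rw [LDual.smul_toL, LDual.toL_zero]; simp
  smul_add s f g := LDual.toL_injective R K M <| LinearMap.ext fun x => by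
    rw [LDual.smul_toL, LDual.toL_add]
    simp only [LinearMap.add_apply, LDual.toL_add]
    rw [LDual.smul_toL, LDual.smul_toL]
  add_smul s t f := LDual.toL_injective R K M <| LinearMap.ext fun x => by
    rw [LDual.smul_toL]
    simp only [LDual.toL_add, LinearMap.add_apply]
    rw [LDual.smul_toL, LDual.smul_toL, unop_add, add_smul, map_add]
  zero_smul f := LDual.toL_injective R K M <| LinearMap.ext fun x => by
    rw [LDual.smul_toL, LDual.toL_zero, unop_zero, zero_smul, map_zero]; rfl

instance : IsScalarTower K Rᵐᵒᵖ (LDual R K M) :=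
  ⟨fun k s f => LDual.toL_injective R K M <| LinearMap.ext fun x => by
    have h1 : LDual.toL R K M ((k • s) • f) x = LDual.toL R K M f (unop (k • s) • x) := rfl
    have h2 : LDual.toL R K M (k • (s • f)) x = k • LDual.toL R K M f (unop s • x) := rfl
    rw [h1, h2, unop_smul, smul_assoc, map_smul]⟩

end LDual

section GI

variable (R : Type u) [Ring R] (K : Type u) [Field K] [Algebra K R]

/-- `M` is Gorenstein injective: there is a doubly infinite exact sequence of
finitely generated injective modules which stays exact under `Hom(DΛ, -)` and
such that `M ≅ Im (I₋₁ → I₀)`. Here `DΛ = OpDual R K R` is the `K`-dual of the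
regular module. -/
def IsGI (M : Type u) [AddCommGroup M] [Module R M] : Prop :=
  ∃ (I : ℤ → Type u) (_ : ∀ n, AddCommGroup (I n)) (_ : ∀ n, Module R (I n))
    (d : ∀ n : ℤ, I n →ₗ[R] I (n + 1)),
    (∀ n, Module.Finite R (I n)) ∧
    (∀ n, Module.Injective R (I n)) ∧
    (∀ n, Function.Exact (d n) (d (n + 1))) ∧
    (∀ n, Function.Exact
      (fun g : OpDual R K R →ₗ[R] I n => (d n).comp g)
      (fun g : OpDual R K R →ₗ[R] I (n + 1) => (d (n + 1)).comp g)) ∧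
    Nonempty (M ≃ₗ[R] LinearMap.range (d (-1)))

end GI



section MinPres

variable (R : Type u) [Ring R]

/-- A minimal projective presentation `P₁ → P₀ → M → 0`. -/
structure MinPres (M : Type u) [AddCommGroup M] [Module R M] : Type (u + 1) where
  P₁ : Type u
  P₀ : Type u
  [acg₁ : AddCommGroup P₁]
  [acg₀ : AddCommGroup P₀]
  [mod₁ : Module R P₁]
  [mod₀ : Module R P₀]
  fin₁ : Module.Finite R P₁
  fin₀ : Module.Finite R P₀
  proj₁ : Module.Projective R P₁
  proj₀ : Module.Projective R P₀
  d : P₁ →ₗ[R] P₀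
  p : P₀ →ₗ[R] M
  surj : Function.Surjective p
  exact : Function.Exact d p
  min₀ : IsSuperfluous R (LinearMap.ker p)
  min₁ : IsSuperfluous R (LinearMap.ker d)

attribute [instance] MinPres.acg₁ MinPres.acg₀ MinPres.mod₁ MinPres.mod₀

variable {R}
variable {M : Type u} [AddCommGroup M] [Module R M] (pr : MinPres R M)

/-- The map `Hom(P₀, R) → Hom(P₁, R)` dual to `d`, as a map of `Rᵐᵒᵖ`-modules. -/
def MinPres.dualMap : (pr.P₀ →ₗ[R] R) →ₗ[Rᵐᵒᵖ] (pr.P₁ →ₗ[R] R) where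
  toFun g := g.comp pr.d
  map_add' g h := by ext x; simp
  map_smul' s g := by ext x; simp

/-- The transpose `Tr M = Coker (Hom(P₀, R) → Hom(P₁, R))`, an `Rᵐᵒᵖ`-module. -/
def MinPres.Tr : Type u := (pr.P₁ →ₗ[R] R) ⧸ LinearMap.range pr.dualMap

instance : AddCommGroup pr.Tr :=
  inferInstanceAs (AddCommGroup ((pr.P₁ →ₗ[R] R) ⧸ LinearMap.range pr.dualMap))

instance : Module Rᵐᵒᵖ pr.Tr :=
  inferInstanceAs (Module Rᵐᵒᵖ ((pr.P₁ →ₗ[R] R) ⧸ LinearMap.range pr.dualMap))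

/-- The canonical projection onto the transpose. -/
def MinPres.toTr (h : pr.P₁ →ₗ[R] R) : pr.Tr :=
  Submodule.Quotient.mk (p := LinearMap.range pr.dualMap) h

section TauDef

variable (K : Type u) [Field K] [Algebra K R]

instance : Module K pr.Tr :=
  inferInstanceAs (Module K ((pr.P₁ →ₗ[R] R) ⧸ LinearMap.range pr.dualMap))

instance : IsScalarTower K Rᵐᵒᵖ pr.Tr :=
  inferInstanceAs
    (IsScalarTower K Rᵐᵒᵖ ((pr.P₁ →ₗ[R] R) ⧸ LinearMap.range pr.dualMap))

/-- The Auslander–Reiten translate `τM = D (Tr M)`, an `R`-module. -/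
def MinPres.tau : Type u := OpDual R K pr.Tr

instance : AddCommGroup (pr.tau K) := inferInstanceAs (AddCommGroup (OpDual R K pr.Tr))

instance : Module R (pr.tau K) := inferInstanceAs (Module R (OpDual R K pr.Tr))

instance : Module K (pr.tau K) := inferInstanceAs (Module K (OpDual R K pr.Tr))

instance : IsScalarTower K R (pr.tau K) :=
  inferInstanceAs (IsScalarTower K R (OpDual R K pr.Tr))

end TauDef

end MinPres

section Tau

variable (R : Type u) [Ring R] (K : Type u) [Field K] [Algebra K R]

/-- `M` is τ-rigid: `Hom(M, τM) = 0`. -/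
def IsTauRigid (M : Type u) [AddCommGroup M] [Module R M] : Prop :=
  ∀ pr : MinPres R M, ∀ f : M →ₗ[R] pr.tau K, f = 0

/-- `N ∈ ⊥(τM)`, i.e. `Hom(N, τM) = 0`. -/
def InPerpTau (M : Type u) [AddCommGroup M] [Module R M]
    (N : Type u) [AddCommGroup N] [Module R N] : Prop :=
  ∀ pr : MinPres R M, ∀ f : N →ₗ[R] pr.tau K, f = 0

/-- `M` is a τ-tilting module: τ-rigid with `|M| = |R|`. -/
def IsTauTilting (M : Type u) [AddCommGroup M] [Module R M] : Prop :=
  IsTauRigid R K M ∧ ∃ m l : ℕ, NumIndec R M m ∧ NumIndec R R l ∧ m = l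

/-- `M` is τ⁻¹-rigid: `Hom(τ⁻¹M, M) = 0`, where `τ⁻¹M = Tr (D M)`.
A homomorphism `τ⁻¹M → M` is an additive map compatible with the identification
`R ≅ Rᵐᵒᵖᵐᵒᵖ` of scalars. -/
def IsTauInvRigid (M : Type u) [AddCommGroup M] [Module R M] [Module K M]
    [IsScalarTower K R M] : Prop :=
  ∀ pr : MinPres Rᵐᵒᵖ (LDual R K M), ∀ f : pr.Tr →+ M,
    (∀ (r : R) (x : pr.Tr), f (op (op r) • x) = r • f x) → f = 0

/-- `M` is a τ⁻¹-tilting module. -/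
def IsTauInvTilting (M : Type u) [AddCommGroup M] [Module R M] [Module K M]
    [IsScalarTower K R M] : Prop :=
  IsTauInvRigid R K M ∧ ∃ m l : ℕ, NumIndec R M m ∧ NumIndec R R l ∧ m = l

end Tau

section Pairs

variable (K : Type u) [Field K] (R : Type u) [Ring R] [Algebra K R]

/-- A pair `(M, P)` of finitely generated modules (with compatible `K`-structure). -/
structure ModPair : Type (u + 1) where
  M : Type u
  [acgM : AddCommGroup M]
  [modM : Module R M]
  [modKM : Module K M]
  [towM : IsScalarTower K R M]
  finM : Module.Finite R M
  P : Type u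
  [acgP : AddCommGroup P]
  [modP : Module R P]
  [modKP : Module K P]
  [towP : IsScalarTower K R P]
  finP : Module.Finite R P

attribute [instance] ModPair.acgM ModPair.modM ModPair.modKM ModPair.towM
attribute [instance] ModPair.acgP ModPair.modP ModPair.modKP ModPair.towP

variable {K R}

/-- Isomorphism of pairs. -/
def ModPair.Iso (x y : ModPair K R) : Prop :=
  Nonempty (x.M ≃ₗ[R] y.M) ∧ Nonempty (x.P ≃ₗ[R] y.P)

variable (K R)

/-- The setoid of pairs satisfying a property `Q`, up to isomorphism. -/
def pairSetoid (Q : ModPair K R → Prop) : Setoid {x : ModPair K R // Q x} where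
  r a b := ModPair.Iso a.1 b.1
  iseqv := by
    constructor
    · exact fun a => ⟨⟨LinearEquiv.refl R a.1.M⟩, ⟨LinearEquiv.refl R a.1.P⟩⟩
    · rintro a b ⟨⟨e⟩, ⟨e'⟩⟩; exact ⟨⟨e.symm⟩, ⟨e'.symm⟩⟩
    · rintro a b c ⟨⟨e⟩, ⟨e'⟩⟩ ⟨⟨f⟩, ⟨f'⟩⟩; exact ⟨⟨e.trans f⟩, ⟨e'.trans f'⟩⟩

/-- `(M, P)` is a τ-rigid pair: `M` is τ-rigid, `P` is projective and `Hom(P, M) = 0`. -/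
def IsTauRigidPair (x : ModPair K R) : Prop :=
  IsTauRigid R K x.M ∧ Module.Projective R x.P ∧ ∀ f : x.P →ₗ[R] x.M, f = 0

/-- A Gorenstein projective τ-rigid pair. -/
def IsGPTauRigidPair (x : ModPair K R) : Prop :=
  IsTauRigidPair K R x ∧ IsGP R x.M

/-- A support τ-tilting pair: a τ-rigid pair with `|M| + |P| = |R|`. -/
def IsSuppTauTiltingPair (x : ModPair K R) : Prop :=
  IsTauRigidPair K R x ∧
    ∃ m p l : ℕ, NumIndec R x.M m ∧ NumIndec R x.P p ∧ NumIndec R R l ∧ m + p = l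

/-- A Gorenstein projective support τ-tilting pair. -/
def IsGPSuppTauTiltingPair (x : ModPair K R) : Prop :=
  IsSuppTauTiltingPair K R x ∧ IsGP R x.M

/-- `(I, N)` is a τ⁻¹-rigid pair; here `x.M = N` is the module and `x.P = I` is
injective, with `Hom(N, I) = 0`. -/
def IsTauInvRigidPair (x : ModPair K R) : Prop :=
  IsTauInvRigid R K x.M ∧ Module.Injective R x.P ∧ ∀ f : x.M →ₗ[R] x.P, f = 0

/-- A Gorenstein injective τ⁻¹-rigid pair. -/
def IsGITauInvRigidPair (x : ModPair K R) : Prop :=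
  IsTauInvRigidPair K R x ∧ IsGI R K x.M

/-- A support τ⁻¹-tilting pair: a τ⁻¹-rigid pair with `|N| + |I| = |R|`. -/
def IsSuppTauInvTiltingPair (x : ModPair K R) : Prop :=
  IsTauInvRigidPair K R x ∧
    ∃ m p l : ℕ, NumIndec R x.M m ∧ NumIndec R x.P p ∧ NumIndec R R l ∧ m + p = l

/-- A Gorenstein injective support τ⁻¹-tilting pair. -/
def IsGISuppTauInvTiltingPair (x : ModPair K R) : Prop :=
  IsSuppTauInvTiltingPair K R x ∧ IsGI R K x.M

/-- A basic pair. -/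
def IsBasicPair (x : ModPair K R) : Prop := IsBasic R x.M ∧ IsBasic R x.P

/-- `y` is (a representative of) the dagger `(M, P)† = (Tr M_np ⊕ P*, M_p*)` of `x`,
where `M = M_p ⊕ M_np` with `M_p` a maximal projective direct summand. -/
def IsDaggerOf (x : ModPair K R) (y : ModPair K Rᵐᵒᵖ) : Prop :=
  ∃ Mp Mnp : Submodule R x.M, IsCompl Mp Mnp ∧ Module.Projective R Mp ∧
    NoProjSummand R Mnp ∧
    ∃ pr : MinPres R Mnp,
      Nonempty (y.M ≃ₗ[Rᵐᵒᵖ] (pr.Tr × (x.P →ₗ[R] R))) ∧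
      Nonempty (y.P ≃ₗ[Rᵐᵒᵖ] (Mp →ₗ[R] R))

/-- `y` is (a representative of) `D((M, P)†)`, the Gorenstein injective pair
`(D(M_p*), D(Tr M_np ⊕ P*))` associated to `x`; in our convention `y.M` is the
τ⁻¹-rigid module `D(Tr M_np ⊕ P*)` and `y.P` is the injective module `D(M_p*)`. -/
def IsDDaggerOf (x : ModPair K R) (y : ModPair K R) : Prop :=
  ∃ z : ModPair K Rᵐᵒᵖ, IsDaggerOf K R x z ∧
    Nonempty (y.M ≃ₗ[R] OpDual R K z.M) ∧ Nonempty (y.P ≃ₗ[R] OpDual R K z.P)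

end Pairs

section Support

variable (R : Type u) [Ring R] (K : Type u) [Field K] [Algebra K R]

/-- `φ : R →+* S` realizes `S` as the quotient of `R` by the two-sided ideal
generated by `e` (universal property). -/
def IsQuotientByIdem (e : R) (S : Type u) [Ring S] (φ : R →+* S) : Prop :=
  Function.Surjective φ ∧ φ e = 0 ∧
    ∀ (S' : Type u) (_ : Ring S') (ψ : R →+* S'), ψ e = 0 → ∃ χ : S →+* S', χ.comp φ = ψ

/-- `M` is a support τ-tilting module: `M` is a τ-tilting module over `Λ/(e)` for
some idempotent `e`. -/
def IsSuppTauTilting (M : Type u) [AddCommGroup M] [Module R M] : Prop :=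
  ∃ e : R, IsIdempotentElem e ∧
    ∃ (S : Type u) (_ : Ring S) (_ : Algebra K S) (φ : R →+* S),
      (∀ k : K, φ (algebraMap K R k) = algebraMap K S k) ∧
      IsQuotientByIdem R e S φ ∧
      ∃ _ : Module S M, (∀ (r : R) (m : M), φ r • m = r • m) ∧ IsTauTilting S K M

/-- `M` is a support τ⁻¹-tilting module: `M` is a τ⁻¹-tilting module over `Λ/(e)`
for some idempotent `e`. -/
def IsSuppTauInvTilting (M : Type u) [AddCommGroup M] [Module R M] [Module K M] : Prop :=
  ∃ e : R, IsIdempotentElem e ∧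
    ∃ (S : Type u) (_ : Ring S) (_ : Algebra K S) (φ : R →+* S),
      (∀ k : K, φ (algebraMap K R k) = algebraMap K S k) ∧
      IsQuotientByIdem R e S φ ∧
      ∃ _ : Module S M, (∀ (r : R) (m : M), φ r • m = r • m) ∧
        ∃ _ : IsScalarTower K S M, IsTauInvTilting S K M

end Support

section Torsion

variable (R : Type u) [Ring R]

/-- A class of modules is closed under isomorphism. -/
def RespectsIso (T : ModuleCat.{u} R → Prop) : Prop :=
  ∀ X Y : ModuleCat.{u} R, Nonempty (X ≃ₗ[R] Y) → T X → T Y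

/-- `(T, F)` is a torsion pair in the category of finitely generated `R`-modules. -/
def IsTorsionPair (T F : ModuleCat.{u} R → Prop) : Prop :=
  RespectsIso R T ∧ RespectsIso R F ∧
  (∀ X, T X → Module.Finite R X) ∧ (∀ X, F X → Module.Finite R X) ∧
  (∀ X Y : ModuleCat.{u} R, T X → F Y → ∀ f : X →ₗ[R] Y, f = 0) ∧
  (∀ X : ModuleCat.{u} R, Module.Finite R X →
    ∃ t : Submodule R X, T (ModuleCat.of R t) ∧ F (ModuleCat.of R (X ⧸ t)))

/-- `T` is covariantly finite: every finitely generated module admits a left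
`T`-approximation. -/
def CovariantlyFinite (T : ModuleCat.{u} R → Prop) : Prop :=
  ∀ X : ModuleCat.{u} R, Module.Finite R X →
    ∃ (M : ModuleCat.{u} R) (f : X →ₗ[R] M), T M ∧
      ∀ (M' : ModuleCat.{u} R) (g : X →ₗ[R] M'), T M' → ∃ h : M →ₗ[R] M', h.comp f = g

/-- `T` is contravariantly finite: every finitely generated module admits a right
`T`-approximation. -/
def ContravariantlyFinite (T : ModuleCat.{u} R → Prop) : Prop :=
  ∀ X : ModuleCat.{u} R, Module.Finite R X →
    ∃ (M : ModuleCat.{u} R) (f : M →ₗ[R] X), T M ∧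
      ∀ (M' : ModuleCat.{u} R) (g : M' →ₗ[R] X), T M' → ∃ h : M' →ₗ[R] M, f.comp h = g

/-- A functorially finite class. -/
def FunctoriallyFinite (T : ModuleCat.{u} R → Prop) : Prop :=
  CovariantlyFinite R T ∧ ContravariantlyFinite R T

/-- `G` is the basic Ext-projective generator of the torsion class `T`:
`G ∈ T` is basic, Ext-projective in `T`, `T = Fac G`, and every Ext-projective
module in `T` lies in `add G`. -/
def IsBasicExtProjGen (T : ModuleCat.{u} R → Prop) (G : ModuleCat.{u} R) : Prop :=
  T G ∧ IsBasic R G ∧ (∀ X : ModuleCat.{u} R, T X → Ext1Vanishes R G X) ∧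
  (∀ X : ModuleCat.{u} R, T X ↔ (Module.Finite R X ∧ FacOf R G X)) ∧
  (∀ X : ModuleCat.{u} R, T X → (∀ Y : ModuleCat.{u} R, T Y → Ext1Vanishes R X Y) →
    InAdd R G X)

/-- `C` is the basic Ext-injective cogenerator of the torsion-free class `F`:
`C ∈ F` is basic, Ext-injective in `F`, `F = Sub C`, and every Ext-injective
module in `F` lies in `add C`. -/
def IsBasicExtInjCogen (F : ModuleCat.{u} R → Prop) (C : ModuleCat.{u} R) : Prop :=
  F C ∧ IsBasic R C ∧ (∀ X : ModuleCat.{u} R, F X → Ext1Vanishes R X C) ∧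
  (∀ X : ModuleCat.{u} R, F X ↔ (Module.Finite R X ∧ SubOf R C X)) ∧
  (∀ X : ModuleCat.{u} R, F X → (∀ Y : ModuleCat.{u} R, F Y → Ext1Vanishes R Y X) →
    InAdd R C X)

variable (K : Type u) [Field K] [Algebra K R]

/-- A (functorially finite) Gorenstein torsion pair: the basic Ext-projective
generator of `T` is Gorenstein projective. -/
def IsGorensteinTP (T F : ModuleCat.{u} R → Prop) : Prop :=
  IsTorsionPair R T F ∧ FunctoriallyFinite R T ∧
    ∀ G : ModuleCat.{u} R, IsBasicExtProjGen R T G → IsGP R G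

/-- A trivial torsion pair: the basic Ext-projective generator of `T` is projective. -/
def IsTrivialTP (T F : ModuleCat.{u} R → Prop) : Prop :=
  IsTorsionPair R T F ∧ FunctoriallyFinite R T ∧
    ∀ G : ModuleCat.{u} R, IsBasicExtProjGen R T G → Module.Projective R G

end Torsion

section Misc

variable (R : Type u) [Ring R] (K : Type u) [Field K] [Algebra K R]

/-- A projective cover `π : P → M`. -/
structure ProjCover (M : Type u) [AddCommGroup M] [Module R M] : Type (u + 1) where
  P : Type u
  [acg : AddCommGroup P]
  [mod : Module R P]
  fin : Module.Finite R P
  proj : Module.Projective R P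
  π : P →ₗ[R] M
  surj : Function.Surjective π
  min : IsSuperfluous R (LinearMap.ker π)

attribute [instance] ProjCover.acg ProjCover.mod

/-- The canonical evaluation map `M → M** = Hom_{Rᵐᵒᵖ}(Hom_R(M, R), Rᵐᵒᵖ)`. -/
def bidualEval (M : Type u) [AddCommGroup M] [Module R M] (m : M) :
    (M →ₗ[R] R) →ₗ[Rᵐᵒᵖ] Rᵐᵒᵖ where
  toFun f := op (f m)
  map_add' f g := by simp
  map_smul' s f := rfl

/-- `R` is CM-τ-tilting finite: up to isomorphism there are only finitely many
indecomposable Gorenstein projective τ-rigid modules. -/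
def CMTauTiltingFinite : Prop :=
  ∃ (n : ℕ) (V : Fin n → ModuleCat.{u} R),
    ∀ (M : Type u) [AddCommGroup M] [Module R M], Module.Finite R M →
      IsIndec R M → IsGP R M → IsTauRigid R K M → ∃ i, Nonempty (M ≃ₗ[R] V i)

/-- `R` is CM-finite: up to isomorphism there are only finitely many
indecomposable Gorenstein projective modules. -/
def CMFinite : Prop :=
  ∃ (n : ℕ) (V : Fin n → ModuleCat.{u} R),
    ∀ (M : Type u) [AddCommGroup M] [Module R M], Module.Finite R M →
      IsIndec R M → IsGP R M → ∃ i, Nonempty (M ≃ₗ[R] V i)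

/-- `T` is the Bongartz completion of the τ-rigid module `M`: the basic
Ext-projective generator of `⊥(τM)`, with `⊥(τM) = Fac T`. -/
def IsBongartzCompletion (M : Type u) [AddCommGroup M] [Module R M]
    (T : Type u) [AddCommGroup T] [Module R T] : Prop :=
  Module.Finite R T ∧ IsBasic R T ∧ InPerpTau R K M T ∧
  (∀ (X : Type u) [AddCommGroup X] [Module R X], Module.Finite R X →
    InPerpTau R K M X → Ext1Vanishes R T X) ∧
  (∀ (X : Type u) [AddCommGroup X] [Module R X], Module.Finite R X →
    (InPerpTau R K M X ↔ FacOf R T X))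

end Misc

section Factorization

variable {A : Type*} [Ring A]

lemma exists_comp_eq_of_ker_le {M N L : Type*} [AddCommGroup M] [Module A M]
    [AddCommGroup N] [Module A N] [AddCommGroup L] [Module A L]
    {q : M →ₗ[A] N} (hq : Surjective q) (g : M →ₗ[A] L)
    (h : ∀ x, q x = 0 → g x = 0) : ∃ φ : N →ₗ[A] L, φ.comp q = g := by
  refine ⟨((LinearMap.ker q).liftQ g fun x hx => h x hx).comp
    (q.quotKerEquivOfSurjective hq).symm.toLinearMap, LinearMap.ext fun x => ?_⟩
  have : (q.quotKerEquivOfSurjective hq).symm (q x) = Submodule.Quotient.mk x := by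
    rw [LinearEquiv.symm_apply_eq]; rfl
  simp only [LinearMap.comp_apply, LinearEquiv.coe_coe, this]
  rfl

lemma exists_comp_eq_of_injective {M N L : Type*} [AddCommGroup M] [Module A M]
    [AddCommGroup N] [Module A N] [AddCommGroup L] [Module A L]
    {i : M →ₗ[A] N} (hi : Injective i) (g : L →ₗ[A] N)
    (h : ∀ x, ∃ y, i y = g x) : ∃ φ : L →ₗ[A] M, i.comp φ = g := by
  refine ⟨(LinearEquiv.ofInjective i hi).symm.toLinearMap.comp
    (g.codRestrict (LinearMap.range i) fun x => by
      obtain ⟨y, hy⟩ := h x; exact ⟨y, hy⟩), LinearMap.ext fun x => ?_⟩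
  have := congrArg Subtype.val ((LinearEquiv.ofInjective i hi).apply_symm_apply
    (g.codRestrict (LinearMap.range i) (fun x => by
      obtain ⟨y, hy⟩ := h x; exact ⟨y, hy⟩) x))
  simp

end Factorization

section GorensteinProjective

variable (A : Type u) [Ring A]

/-- A short exact sequence `0 → X → P → Y → 0` with `P` finitely generated projective
which stays exact under `Hom(-, A)`. -/
def ApproxSES (X Y : Type u) [AddCommGroup X] [Module A X] [AddCommGroup Y] [Module A Y] :
    Prop :=
  ∃ (P : Type u) (_ : AddCommGroup P) (_ : Module A P) (_ : Module.Finite A P)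
    (_ : Module.Projective A P) (i : X →ₗ[A] P) (q : P →ₗ[A] Y),
    Injective i ∧ Surjective q ∧ Exact i q ∧ ∀ φ : X →ₗ[A] A, ∃ ψ : P →ₗ[A] A, ψ.comp i = φ

/-- A class of modules each of whose members is both a syzygy and a cosyzygy of a member. -/
def IsGPClass (C : ModuleCat.{u} A → Prop) : Prop :=
  ∀ X : ModuleCat.{u} A, C X →
    (∃ Y : ModuleCat.{u} A, C Y ∧ ApproxSES A X Y) ∧ ∃ Y : ModuleCat.{u} A, C Y ∧ ApproxSES A Y X

variable {A}

lemma ApproxSES.congr {X Y X' Y' : Type u} [AddCommGroup X] [Module A X]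
    [AddCommGroup Y] [Module A Y] [AddCommGroup X'] [Module A X']
    [AddCommGroup Y'] [Module A Y'] (h : ApproxSES A X Y) (e : X' ≃ₗ[A] X) (f : Y ≃ₗ[A] Y') :
    ApproxSES A X' Y' := by
  obtain ⟨P, _, _, hf, hp, i, q, hi, hq, hex, hd⟩ := h
  refine ⟨P, _, _, hf, hp, i.comp e.toLinearMap, f.toLinearMap.comp q, ?_, ?_, ?_, ?_⟩
  · exact hi.comp e.injective
  · exact f.surjective.comp hq
  · intro x
    have := hex x
    simp only [LinearMap.comp_apply, LinearEquiv.coe_coe, Set.mem_range,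
      LinearEquiv.map_eq_zero_iff] at this ⊢
    rw [this]
    exact ⟨fun ⟨y, hy⟩ => ⟨e.symm y, by simpa using hy⟩, fun ⟨y, hy⟩ => ⟨e y, hy⟩⟩
  · intro φ
    obtain ⟨ψ, hψ⟩ := hd (φ.comp e.symm.toLinearMap)
    refine ⟨ψ, LinearMap.ext fun x => ?_⟩
    simpa using LinearMap.congr_fun hψ (e x)

lemma isGP_of_chain (Z : ℤ → ModuleCat.{u} A) (h : ∀ n, ApproxSES A (Z n) (Z (n + 1))) :
    IsGP A (Z 0) := by
  choose P acg mod fin proj i q hi hq hex hd using h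
  refine ⟨P, acg, mod, fun n => (i (n + 1)).comp (q n), fin, proj, ?_, ?_, ⟨?_⟩⟩
  · intro n x
    have := hex (n + 1) x
    simp only [LinearMap.comp_apply, Set.mem_range]
    constructor
    · intro hx
      obtain ⟨y, rfl⟩ := this.1 ((injective_iff_map_eq_zero _).1 (hi (n + 1 + 1)) _ hx)
      obtain ⟨z, rfl⟩ := hq n y
      exact ⟨z, rfl⟩
    · rintro ⟨z, rfl⟩
      rw [(hex (n + 1)).apply_apply_eq_zero, map_zero]
  · intro n g
    constructor
    · intro hg
      obtain ⟨φ, hφ⟩ := exists_comp_eq_of_ker_le (hq (n + 1)) g (fun x hx => by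
        obtain ⟨y, rfl⟩ := (hex (n + 1) x).1 hx
        obtain ⟨z, rfl⟩ := hq n y
        exact LinearMap.congr_fun hg z)
      obtain ⟨ψ, hψ⟩ := hd (n + 1 + 1) φ
      refine ⟨ψ, ?_⟩
      change (ψ.comp ((i (n + 1 + 1)).comp (q (n + 1)))) = g
      rw [← LinearMap.comp_assoc, hψ, hφ]
    · rintro ⟨ψ, rfl⟩
      refine LinearMap.ext fun x => ?_
      simp [(hex (n + 1)).apply_apply_eq_zero]
  · have : LinearMap.range ((i (-1 + 1)).comp (q (-1))) = LinearMap.range (i (-1 + 1)) := by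
      rw [LinearMap.range_comp, LinearMap.range_eq_top.2 (hq (-1)), Submodule.map_top]
    exact (LinearEquiv.ofInjective (i (-1 + 1)) (hi (-1 + 1))).trans
      (LinearEquiv.ofEq _ _ this.symm)

lemma isGP_congr {M N : Type u} [AddCommGroup M] [Module A M] [AddCommGroup N] [Module A N]
    (e : M ≃ₗ[A] N) (h : IsGP A M) : IsGP A N := by
  obtain ⟨P, acg, mod, d, h1, h2, h3, h4, ⟨f⟩⟩ := h
  exact ⟨P, acg, mod, d, h1, h2, h3, h4, ⟨e.symm.trans f⟩⟩

lemma IsGPClass.isGP {C : ModuleCat.{u} A → Prop} (hC : IsGPClass A C) (X : ModuleCat.{u} A)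
    (hX : C X) : IsGP A X := by
  choose! r hr hr' using fun X hX => (hC X hX).1
  choose! l hl hl' using fun X hX => (hC X hX).2
  have hrn : ∀ n : ℕ, C (r^[n] X) := fun n => by
    induction n with
    | zero => exact hX
    | succ n ih => rw [Function.iterate_succ_apply']; exact hr _ ih
  have hln : ∀ n : ℕ, C (l^[n] X) := fun n => by
    induction n with
    | zero => exact hX
    | succ n ih => rw [Function.iterate_succ_apply']; exact hl _ ih
  let Z : ℤ → ModuleCat.{u} A := fun n => match n with
    | Int.ofNat n => r^[n] X
    | Int.negSucc n => l^[n + 1] X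
  refine isGP_of_chain Z fun n => ?_
  match n with
  | Int.ofNat n =>
    have h := hr' _ (hrn n)
    rw [← Function.iterate_succ_apply' r n X] at h
    exact h
  | Int.negSucc 0 => exact hl' _ hX
  | Int.negSucc (n + 1) =>
    have h := hl' _ (hln (n + 1))
    rw [← Function.iterate_succ_apply' l (n + 1) X] at h
    exact h

lemma isGPClass_isGP : IsGPClass A (fun X => IsGP A X) := by
  have key : ∀ X : ModuleCat.{u} A, IsGP A X → ∃ C, IsGPClass A C ∧ C X := by
    rintro X ⟨P, acg, mod, d, hfin, hproj, hex, hd, ⟨e⟩⟩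
    let Z : ℤ → ModuleCat.{u} A := fun n => ModuleCat.of A (LinearMap.range (d n))
    have hZ : ∀ n, ApproxSES A (Z n) (Z (n + 1)) := by
      intro n
      refine ⟨P (n + 1), acg _, mod _, hfin _, hproj _, (LinearMap.range (d n)).subtype,
        (d (n + 1)).rangeRestrict, Subtype.val_injective,
        LinearMap.surjective_rangeRestrict _, ?_, ?_⟩
      · intro x
        have := hex n x
        rw [Subtype.ext_iff]
        refine this.trans ⟨?_, ?_⟩
        · rintro ⟨y, rfl⟩
          exact ⟨⟨_, LinearMap.mem_range_self _ y⟩, rfl⟩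
        · rintro ⟨⟨_, y, rfl⟩, rfl⟩
          exact ⟨y, rfl⟩
      · intro φ
        obtain ⟨m, rfl⟩ : ∃ m, n = m + 1 := ⟨n - 1, by ring⟩
        obtain ⟨ψ, hψ⟩ := (hd m (φ.comp (d (m + 1)).rangeRestrict)).1 (by
          refine LinearMap.ext fun x => ?_
          change φ ((d (m + 1)).rangeRestrict (d m x)) = 0
          have : (d (m + 1)).rangeRestrict (d m x) = 0 :=
            Subtype.ext ((hex m).apply_apply_eq_zero x)
          rw [this, map_zero])
        refine ⟨ψ, LinearMap.ext ?_⟩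
        rintro ⟨_, y, rfl⟩
        exact LinearMap.congr_fun hψ y
    refine ⟨fun X => ∃ n, Nonempty (X ≃ₗ[A] Z n), ?_, -1, ⟨e⟩⟩
    rintro Y ⟨n, ⟨f⟩⟩
    refine ⟨⟨Z (n + 1), ⟨n + 1, ⟨LinearEquiv.refl _ _⟩⟩, (hZ n).congr f (LinearEquiv.refl _ _)⟩, ?_⟩
    obtain ⟨m, rfl⟩ : ∃ m, n = m + 1 := ⟨n - 1, by ring⟩
    exact ⟨Z m, ⟨m, ⟨LinearEquiv.refl _ _⟩⟩, (hZ m).congr (LinearEquiv.refl _ _) f.symm⟩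
  intro X hX
  obtain ⟨C, hC, hCX⟩ := key X hX
  obtain ⟨⟨Y, hY, hXY⟩, ⟨W, hW, hWX⟩⟩ := hC X hCX
  exact ⟨⟨Y, hC.isGP Y hY, hXY⟩, ⟨W, hC.isGP W hW, hWX⟩⟩

lemma IsGP.exists_right {M : Type u} [AddCommGroup M] [Module A M] (h : IsGP A M) :
    ∃ (Y : Type u) (_ : AddCommGroup Y) (_ : Module A Y), IsGP A Y ∧ ApproxSES A M Y := by
  obtain ⟨⟨Y, hY, h⟩, -⟩ := isGPClass_isGP (ModuleCat.of A M) h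
  exact ⟨Y, _, _, hY, h⟩

lemma IsGP.exists_left {M : Type u} [AddCommGroup M] [Module A M] (h : IsGP A M) :
    ∃ (Y : Type u) (_ : AddCommGroup Y) (_ : Module A Y), IsGP A Y ∧ ApproxSES A Y M := by
  obtain ⟨-, ⟨Y, hY, h⟩⟩ := isGPClass_isGP (ModuleCat.of A M) h
  exact ⟨Y, _, _, hY, h⟩

lemma IsGP.finite {M : Type u} [AddCommGroup M] [Module A M] (h : IsGP A M) :
    Module.Finite A M := by
  obtain ⟨Y, _, _, -, P, _, _, hf, -, i, q, -, hq, -⟩ := h.exists_left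
  exact Module.Finite.of_surjective q hq

lemma isGP_of_projective (P : Type u) [AddCommGroup P] [Module A P] [Module.Finite A P]
    [Module.Projective A P] : IsGP A P := by
  have hC : IsGPClass A (fun X => Module.Finite A X ∧ Module.Projective A X) := by
    rintro X ⟨hf, hp⟩
    refine ⟨⟨ModuleCat.of A PUnit.{u + 1}, ⟨inferInstanceAs (Module.Finite A PUnit.{u + 1}),
        inferInstanceAs (Module.Projective A PUnit.{u + 1})⟩, X, _, _, hf, hp, LinearMap.id, 0,
        injective_id, fun y => ⟨0, Subsingleton.elim _ _⟩, ?_, fun φ => ⟨φ, rfl⟩⟩,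
      ⟨ModuleCat.of A PUnit.{u + 1}, ⟨inferInstanceAs (Module.Finite A PUnit.{u + 1}),
        inferInstanceAs (Module.Projective A PUnit.{u + 1})⟩, X, _, _, hf, hp, 0, LinearMap.id,
        injective_of_subsingleton _, surjective_id, ?_, fun φ => ⟨0, ?_⟩⟩⟩
    · intro x; simp
    · intro x
      exact ⟨fun h => ⟨0, h.symm⟩, fun ⟨_, h⟩ => h.symm⟩
    · ext x
      rw [Subsingleton.elim x 0, map_zero, map_zero]
  exact hC.isGP (ModuleCat.of A P) ⟨‹_›, ‹_›⟩

lemma ApproxSES.prod {X Y X' Y' : Type u} [AddCommGroup X] [Module A X]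
    [AddCommGroup Y] [Module A Y] [AddCommGroup X'] [Module A X']
    [AddCommGroup Y'] [Module A Y'] (h : ApproxSES A X Y) (h' : ApproxSES A X' Y') :
    ApproxSES A (X × X') (Y × Y') := by
  obtain ⟨P, _, _, hf, hp, i, q, hi, hq, hex, hd⟩ := h
  obtain ⟨P', _, _, hf', hp', i', q', hi', hq', hex', hd'⟩ := h'
  refine ⟨P × P', _, _, inferInstance, inferInstance, i.prodMap i', q.prodMap q',
    hi.prodMap hi', hq.prodMap hq', ?_, ?_⟩
  · rintro ⟨x, y⟩
    have h1 := hex x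
    have h2 := hex' y
    simp only [LinearMap.prodMap_apply, Prod.mk_eq_zero, h1, h2, Set.mem_range, Prod.exists,
      Prod.mk.injEq]
    exact ⟨fun ⟨⟨a, ha⟩, ⟨b, hb⟩⟩ => ⟨a, b, ha, hb⟩, fun ⟨a, b, ha, hb⟩ => ⟨⟨a, ha⟩, ⟨b, hb⟩⟩⟩
  · intro φ
    obtain ⟨ψ, hψ⟩ := hd (φ.comp (LinearMap.inl A X X'))
    obtain ⟨ψ', hψ'⟩ := hd' (φ.comp (LinearMap.inr A X X'))
    refine ⟨ψ.coprod ψ', ?_⟩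
    ext x
    · simpa using LinearMap.congr_fun hψ x
    · simpa using LinearMap.congr_fun hψ' x

lemma IsGP.prod {M N : Type u} [AddCommGroup M] [Module A M] [AddCommGroup N] [Module A N]
    (hM : IsGP A M) (hN : IsGP A N) : IsGP A (M × N) := by
  have hC : IsGPClass A (fun X => ∃ (M N : ModuleCat.{u} A), IsGP A M ∧ IsGP A N ∧
      Nonempty (X ≃ₗ[A] M × N)) := by
    rintro X ⟨M, N, hM, hN, ⟨e⟩⟩
    obtain ⟨⟨Y, hY, h⟩, ⟨Z, hZ, g⟩⟩ := isGPClass_isGP M hM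
    obtain ⟨⟨Y', hY', h'⟩, ⟨Z', hZ', g'⟩⟩ := isGPClass_isGP N hN
    exact ⟨⟨ModuleCat.of A (Y × Y'), ⟨Y, Y', hY, hY', ⟨LinearEquiv.refl _ _⟩⟩,
      (h.prod h').congr e (LinearEquiv.refl _ _)⟩,
      ⟨ModuleCat.of A (Z × Z'), ⟨Z, Z', hZ, hZ', ⟨LinearEquiv.refl _ _⟩⟩,
      (g.prod g').congr (LinearEquiv.refl _ _) e.symm⟩⟩
  exact hC.isGP (ModuleCat.of A (M × N)) ⟨ModuleCat.of A M, ModuleCat.of A N, hM, hN,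
    ⟨LinearEquiv.refl _ _⟩⟩

lemma IsGP.pi {M : Type u} [AddCommGroup M] [Module A M] (hM : IsGP A M) (n : ℕ) :
    IsGP A (Fin n → M) := by
  induction n with
  | zero =>
    exact isGP_congr (LinearEquiv.ofSubsingleton PUnit.{u + 1} (Fin 0 → M))
      (isGP_of_projective PUnit)
  | succ n ih => exact isGP_congr (Fin.consLinearEquiv A fun _ : Fin (n + 1) => M) (hM.prod ih)

lemma IsGP.of_retract {X M : Type u} [AddCommGroup X] [Module A X] [AddCommGroup M] [Module A M]
    (hM : IsGP A M) (i : X →ₗ[A] M) (p : M →ₗ[A] X) (hpi : p.comp i = LinearMap.id) :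
    IsGP A X := by
  have hC : IsGPClass A (fun X => ∃ (M : ModuleCat.{u} A) (i : X →ₗ[A] M) (p : M →ₗ[A] X),
      IsGP A M ∧ p.comp i = LinearMap.id) := by
    rintro X ⟨M, i, p, hM, hpi⟩
    have hpi' : ∀ x, p (i x) = x := LinearMap.congr_fun hpi
    constructor
    · obtain ⟨M'', _, _, hM'', P, _, _, hf, hp, j, q, hj, hq, hex, hd⟩ := hM.exists_right
      have hji : Injective (j.comp i) := hj.comp (LeftInverse.injective hpi')
      obtain ⟨E, hE⟩ : ∃ E : P →ₗ[A] P, E.comp j = j.comp (i.comp p) := by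
        have hdP : ∀ (Q : Type u) [AddCommGroup Q] [Module A Q] [Module.Finite A Q]
            [Module.Projective A Q] (φ : M →ₗ[A] Q), ∃ ψ : P →ₗ[A] Q, ψ.comp j = φ := by
          intro Q _ _ _ _ φ
          obtain ⟨n, f, g, hf, hg, hfg⟩ := Module.Finite.exists_comp_eq_id_of_projective A Q
          choose ψ hψ using fun k : Fin n => hd ((LinearMap.proj k).comp (g.comp φ))
          refine ⟨f.comp (LinearMap.pi ψ), LinearMap.ext fun x => ?_⟩
          have : (LinearMap.pi ψ) (j x) = g (φ x) := funext fun k => LinearMap.congr_fun (hψ k) x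
          simp only [LinearMap.comp_apply, this]
          exact LinearMap.congr_fun hfg (φ x)
        exact hdP P _
      have hE' : ∀ x, E (j x) = j (i (p x)) := LinearMap.congr_fun hE
      let R := LinearMap.range (j.comp i)
      obtain ⟨s, hs⟩ := exists_comp_eq_of_ker_le (q := R.mkQ) (Submodule.mkQ_surjective R)
        (q.prod (LinearMap.id - E)) (fun x hx => by
          obtain ⟨y, rfl⟩ := (Submodule.Quotient.mk_eq_zero _).1 hx
          simp [hex.apply_apply_eq_zero, hE', hpi'])
      obtain ⟨t, ht⟩ := exists_comp_eq_of_ker_le hq (R.mkQ.comp E) (fun x hx => by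
          obtain ⟨y, rfl⟩ := (hex x).1 hx
          simp only [LinearMap.comp_apply, hE']
          exact (Submodule.Quotient.mk_eq_zero _).2 ⟨p y, rfl⟩)
      refine ⟨ModuleCat.of A (P ⧸ R), ⟨ModuleCat.of A (M'' × P), s, t.coprod R.mkQ,
        hM''.prod (isGP_of_projective P), ?_⟩, P, _, _, hf, hp, j.comp i, R.mkQ, hji,
        Submodule.mkQ_surjective R, ?_, ?_⟩
      · refine LinearMap.ext fun y => ?_
        obtain ⟨x, rfl⟩ := Submodule.mkQ_surjective R y
        have h1 := LinearMap.congr_fun hs x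
        have h2 := LinearMap.congr_fun ht x
        simp only [LinearMap.comp_apply, LinearMap.prod_apply, Function.prod] at h1 h2
        simp only [LinearMap.comp_apply, h1, LinearMap.coprod_apply, h2, LinearMap.id_apply,
          LinearMap.sub_apply, map_sub]
        abel
      · exact LinearMap.exact_map_mkQ_range _
      · intro φ
        obtain ⟨ψ, hψ⟩ := hd (φ.comp p)
        refine ⟨ψ, LinearMap.ext fun x => ?_⟩
        simpa [hpi'] using LinearMap.congr_fun hψ (i x)
    · obtain ⟨M', _, _, hM', P, _, _, hf, hp, j, q, hj, hq, hex, hd⟩ := hM.exists_left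
      obtain ⟨E, hE⟩ := Module.projective_lifting_property q ((i.comp p).comp q) hq
      have hE' : ∀ x, q (E x) = i (p (q x)) := LinearMap.congr_fun hE
      have hp_surj : Surjective p := fun x => ⟨i x, hpi' x⟩
      let N := LinearMap.ker (p.comp q)
      have hN : ∀ y : N, p (q y) = 0 := fun y => y.2
      have hjN : ∀ m, j m ∈ N := fun m => by
        change p (q (j m)) = 0
        rw [hex.apply_apply_eq_zero, map_zero]
      obtain ⟨s, hs⟩ := exists_comp_eq_of_injective hj (E.comp N.subtype) (fun y => by
        obtain ⟨m, hm⟩ := (hex (E y)).1 (by rw [hE', hN, map_zero])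
        exact ⟨m, hm⟩)
      have hs' : ∀ y : N, j (s y) = E y := LinearMap.congr_fun hs
      let t : P →ₗ[A] N := (LinearMap.id - E).codRestrict N (fun y => by
        change p (q (y - E y)) = 0
        rw [map_sub, hE', map_sub, hpi', sub_self])
      let j' : M' →ₗ[A] N := j.codRestrict N hjN
      refine ⟨ModuleCat.of A N, ⟨ModuleCat.of A (M' × P), s.prod N.subtype, j'.coprod t,
        hM'.prod (isGP_of_projective P), ?_⟩, P, _, _, hf, hp, N.subtype, p.comp q,
        Subtype.val_injective, hp_surj.comp hq, ?_, ?_⟩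
      · refine LinearMap.ext fun y => Subtype.ext ?_
        change j (s y) + (y - E y) = y
        rw [hs']; abel
      · exact LinearMap.exact_subtype_ker_map _
      · intro φ
        obtain ⟨ψ, hψ⟩ := hd (φ.comp j')
        have hψ' : ∀ m, ψ (j m) = φ (j' m) := LinearMap.congr_fun hψ
        refine ⟨ψ.comp E + φ.comp t, LinearMap.ext fun y => ?_⟩
        change ψ (E y) + φ (t y) = φ y
        rw [← hs', hψ', ← map_add]
        congr 1
        refine Subtype.ext ?_
        change j (s y) + (y - E y) = y
        rw [hs']; abel
  exact hC.isGP (ModuleCat.of A X) ⟨ModuleCat.of A M, i, p, hM, hpi⟩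

lemma IsGP.of_inAdd {G X : Type u} [AddCommGroup X] [Module A X] [AddCommGroup G] [Module A G]
    (hG : IsGP A G) (h : InAdd A G X) : IsGP A X := by
  obtain ⟨n, i, p, hpi⟩ := h
  exact (hG.pi n).of_retract i p hpi

/-- The kernel `K` of an epimorphism from a finitely generated projective module `P` onto a
Gorenstein projective module is Gorenstein projective, and functionals on `K` extend to `P`. -/
lemma IsGP.syzygy {K P M : Type u} [AddCommGroup K] [Module A K] [AddCommGroup P] [Module A P]
    [AddCommGroup M] [Module A M] [Module.Finite A P] [Module.Projective A P]
    (hM : IsGP A M) (k : K →ₗ[A] P) (π : P →ₗ[A] M) (hk : Injective k) (hπ : Surjective π)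
    (hex : Exact k π) :
    IsGP A K ∧ ∀ φ : K →ₗ[A] A, ∃ ψ : P →ₗ[A] A, ψ.comp k = φ := by
  obtain ⟨M', _, _, hM', Q, _, _, hf, hp, j, q, hj, hq, hex', hd⟩ := hM.exists_left
  obtain ⟨s, hs⟩ := Module.projective_lifting_property q π hq
  obtain ⟨t, ht⟩ := Module.projective_lifting_property π q hπ
  have hs' : ∀ x, q (s x) = π x := LinearMap.congr_fun hs
  have ht' : ∀ x, π (t x) = q x := LinearMap.congr_fun ht
  obtain ⟨a, ha⟩ := exists_comp_eq_of_injective hj (s.comp k) (fun x => by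
    obtain ⟨m, hm⟩ := (hex' (s (k x))).1 (by rw [hs', hex.apply_apply_eq_zero])
    exact ⟨m, hm⟩)
  obtain ⟨b, hb⟩ := exists_comp_eq_of_injective hk
    ((LinearMap.id : P →ₗ[A] P).coprod 0 - t.comp (s.coprod (-j))) (fun x => by
    obtain ⟨m, hm⟩ := (hex (x.1 - t (s x.1 - j x.2))).1 (by
      rw [map_sub, ht', map_sub, hs', hex'.apply_apply_eq_zero]; simp)
    exact ⟨m, by simp [hm, sub_eq_add_neg]⟩)
  have ha' : ∀ x, j (a x) = s (k x) := LinearMap.congr_fun ha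
  have hba : ∀ x, b (k x, a x) = x := fun x => hk <| by
    have h1 := LinearMap.congr_fun hb (k x, a x)
    simp only [LinearMap.comp_apply] at h1
    rw [h1]
    simp [ha']
  refine ⟨((isGP_of_projective P).prod hM').of_retract (k.prod a) b (LinearMap.ext hba),
    fun φ => ?_⟩
  obtain ⟨χ, hχ⟩ := hd (φ.comp (b.comp (LinearMap.inr A P M')))
  have hχ' : ∀ x, χ (j x) = φ (b (0, x)) := LinearMap.congr_fun hχ
  refine ⟨φ.comp (b.comp (LinearMap.inl A P M')) + χ.comp s, LinearMap.ext fun x => ?_⟩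
  change φ (b (k x, 0)) + χ (s (k x)) = φ x
  rw [← ha', hχ', ← map_add, ← map_add, Prod.mk_add_mk, add_zero, zero_add, hba]

end GorensteinProjective

section RingEquivTransport

variable {A B : Type u} [Ring A] [Ring B]

/-- A `B`-linear map is `A`-linear for the module structures obtained along `A ≃+* B`. -/
def restrictAlong (e : A ≃+* B) {X Y : Type*} [AddCommGroup X] [AddCommGroup Y]
    [Module A X] [Module B X] [Module A Y] [Module B Y]
    (hX : ∀ (a : A) (x : X), a • x = e a • x) (hY : ∀ (a : A) (y : Y), a • y = e a • y)
    (f : X →ₗ[B] Y) : X →ₗ[A] Y where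
  toFun := f
  map_add' := f.map_add
  map_smul' a x := by rw [hX, f.map_smul, RingHom.id_apply, hY]

lemma ApproxSES.of_ringEquiv (e : A ≃+* B) {X Y : Type u} [AddCommGroup X] [AddCommGroup Y]
    [Module A X] [Module B X] [Module A Y] [Module B Y]
    (hX : ∀ (a : A) (x : X), a • x = e a • x) (hY : ∀ (a : A) (y : Y), a • y = e a • y)
    (h : ApproxSES B X Y) : ApproxSES A X Y := by
  obtain ⟨P, _, _, hf, hp, i, q, hi, hq, hex, hd⟩ := h
  let _ : Module A P := Module.compHom P e.toRingHom
  have hP : ∀ (a : A) (x : P), a • x = e a • x := fun _ _ => rfl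
  have := RingHomInvPair.of_ringEquiv e
  have := RingHomInvPair.symm (e : A →+* B) (e.symm : B →+* A)
  let eP : P ≃ₛₗ[(e.symm : B →+* A)] P :=
    { AddEquiv.refl P with
      map_smul' := fun b x => by
        change b • x = e (e.symm b) • x
        rw [e.apply_symm_apply] }
  refine ⟨P, _, _, Module.Finite.of_surjective eP.toLinearMap eP.surjective,
    Module.Projective.of_equiv eP, restrictAlong e hX hP i, restrictAlong e hP hY q, hi, hq, hex,
    fun φ => ?_⟩
  obtain ⟨ψ, hψ⟩ := hd
    { toFun := fun x => e (φ x)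
      map_add' := fun x y => by simp
      map_smul' := fun b x => by
        rw [← e.apply_symm_apply b, ← hX, φ.map_smul]; simp }
  refine ⟨{ toFun := fun x => e.symm (ψ x)
            map_add' := fun x y => by simp
            map_smul' := fun a x => by rw [hP, ψ.map_smul]; simp }, LinearMap.ext fun x => ?_⟩
  have : ψ (i x) = e (φ x) := LinearMap.congr_fun hψ x
  change e.symm (ψ (i x)) = φ x
  rw [this, e.symm_apply_apply]

lemma IsGP.of_ringEquiv (e : A ≃+* B) {X : Type u} [AddCommGroup X] [Module A X] [Module B X]
    (hX : ∀ (a : A) (x : X), a • x = e a • x) (h : IsGP B X) : IsGP A X := by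
  have hC : IsGPClass A (fun X => ∃ (_ : Module B X), (∀ (a : A) (x : X), a • x = e a • x) ∧
      IsGP B X) := by
    rintro X ⟨_, hX, h⟩
    constructor
    · obtain ⟨Y, _, _, hY, h⟩ := h.exists_right
      let _ : Module A Y := Module.compHom Y e.toRingHom
      exact ⟨ModuleCat.of A Y, ⟨inferInstanceAs (Module B Y), fun _ _ => rfl, hY⟩,
        h.of_ringEquiv e hX fun _ _ => rfl⟩
    · obtain ⟨Y, _, _, hY, h⟩ := h.exists_left
      let _ : Module A Y := Module.compHom Y e.toRingHom
      exact ⟨ModuleCat.of A Y, ⟨inferInstanceAs (Module B Y), fun _ _ => rfl, hY⟩,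
        h.of_ringEquiv e (fun _ _ => rfl) hX⟩
  exact hC.isGP (ModuleCat.of A X) ⟨inferInstanceAs (Module B X), hX, h⟩

end RingEquivTransport

section Transpose

variable {A : Type u} [Ring A]

lemma exists_dual_basis (P : Type u) [AddCommGroup P] [Module A P]
    [Module.Finite A P] [Module.Projective A P] :
    ∃ (n : ℕ) (x : Fin n → P) (f : Fin n → P →ₗ[A] A), ∀ p, ∑ i, f i p • x i = p := by
  obtain ⟨n, f, g, -, -, hfg⟩ := Module.Finite.exists_comp_eq_id_of_projective A P
  refine ⟨n, fun i => f (fun j => if i = j then 1 else 0), fun i => (LinearMap.proj i).comp g,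
    fun p => ?_⟩
  have := LinearMap.congr_fun hfg p
  rw [LinearMap.comp_apply, LinearMap.pi_apply_eq_sum_univ f] at this
  exact this

lemma eq_zero_of_forall_functional {P : Type u} [AddCommGroup P] [Module A P]
    [Module.Finite A P] [Module.Projective A P] {p : P} (h : ∀ φ : P →ₗ[A] A, φ p = 0) :
    p = 0 := by
  obtain ⟨n, x, f, hf⟩ := exists_dual_basis (A := A) P
  rw [← hf p]
  exact Finset.sum_eq_zero fun i _ => by rw [h, zero_smul]

lemma sum_op_smul_functional {P : Type u} [AddCommGroup P] [Module A P] {n : ℕ}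
    {x : Fin n → P} {f : Fin n → P →ₗ[A] A} (hf : ∀ p, ∑ i, f i p • x i = p)
    (φ : P →ₗ[A] A) : ∑ i, op (φ (x i)) • f i = φ := by
  refine LinearMap.ext fun p => ?_
  conv_rhs => rw [← hf p]
  simp [LinearMap.sum_apply]

instance functionals_finite (P : Type u) [AddCommGroup P] [Module A P]
    [Module.Finite A P] [Module.Projective A P] : Module.Finite Aᵐᵒᵖ (P →ₗ[A] A) := by
  obtain ⟨n, x, f, hf⟩ := exists_dual_basis (A := A) P
  refine Module.Finite.of_surjective
    (∑ i : Fin n, (LinearMap.proj i : (Fin n → Aᵐᵒᵖ) →ₗ[Aᵐᵒᵖ] Aᵐᵒᵖ).smulRight (f i)) fun φ => ?_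
  refine ⟨fun i => op (φ (x i)), ?_⟩
  simpa [LinearMap.sum_apply] using sum_op_smul_functional hf φ

instance functionals_projective (P : Type u) [AddCommGroup P] [Module A P]
    [Module.Finite A P] [Module.Projective A P] : Module.Projective Aᵐᵒᵖ (P →ₗ[A] A) := by
  obtain ⟨n, x, f, hf⟩ := exists_dual_basis (A := A) P
  refine Module.Projective.of_split (M := Fin n → Aᵐᵒᵖ)
    (LinearMap.pi fun i =>
      { toFun := fun φ : P →ₗ[A] A => op (φ (x i))
        map_add' := fun _ _ => by simp
        map_smul' := fun _ _ => by simp })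
    (∑ i : Fin n, (LinearMap.proj i : (Fin n → Aᵐᵒᵖ) →ₗ[Aᵐᵒᵖ] Aᵐᵒᵖ).smulRight (f i)) ?_
  refine LinearMap.ext fun φ => ?_
  simpa [LinearMap.sum_apply] using sum_op_smul_functional hf φ

lemma exists_eq_bidualEval {P : Type u} [AddCommGroup P] [Module A P]
    [Module.Finite A P] [Module.Projective A P] (Φ : (P →ₗ[A] A) →ₗ[Aᵐᵒᵖ] Aᵐᵒᵖ) :
    ∃ p, bidualEval A P p = Φ := by
  obtain ⟨n, x, f, hf⟩ := exists_dual_basis (A := A) P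
  refine ⟨∑ i, unop (Φ (f i)) • x i, LinearMap.ext fun φ => unop_injective ?_⟩
  conv_rhs => rw [← sum_op_smul_functional hf φ]
  change φ _ = _
  simp

/-- Precomposition with `d`, as a map of right modules. -/
def functionalsMap {P Q : Type u} [AddCommGroup P] [Module A P] [AddCommGroup Q] [Module A Q]
    (d : P →ₗ[A] Q) : (Q →ₗ[A] A) →ₗ[Aᵐᵒᵖ] (P →ₗ[A] A) where
  toFun g := g.comp d
  map_add' g h := by ext x; simp
  map_smul' s g := by ext x; simp

variable {Q₂ Q₁ Q₀ : Type u} [AddCommGroup Q₂] [Module A Q₂] [AddCommGroup Q₁] [Module A Q₁]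
  [AddCommGroup Q₀] [Module A Q₀] [Module.Finite A Q₂] [Module.Projective A Q₂]
  [Module.Finite A Q₁] [Module.Projective A Q₁] [Module.Finite A Q₀] [Module.Projective A Q₀]

lemma approxSES_coker_functionalsMap (d₂ : Q₂ →ₗ[A] Q₁) (d : Q₁ →ₗ[A] Q₀) (hex : Exact d₂ d)
    (hd : ∀ φ : Q₁ →ₗ[A] A, φ.comp d₂ = 0 → ∃ ψ : Q₀ →ₗ[A] A, ψ.comp d = φ) :
    ApproxSES Aᵐᵒᵖ ((Q₁ →ₗ[A] A) ⧸ LinearMap.range (functionalsMap d))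
      ((Q₂ →ₗ[A] A) ⧸ LinearMap.range (functionalsMap d₂)) := by
  have hker : LinearMap.range (functionalsMap d) ≤ LinearMap.ker (functionalsMap d₂) := by
    rintro _ ⟨ψ, rfl⟩
    refine LinearMap.ext fun x => ?_
    change ψ (d (d₂ x)) = 0
    rw [hex.apply_apply_eq_zero, map_zero]
  refine ⟨Q₂ →ₗ[A] A, inferInstance, inferInstance, inferInstance, inferInstance,
    (LinearMap.range (functionalsMap d)).liftQ (functionalsMap d₂) hker,
    Submodule.mkQ _, ?_, Submodule.mkQ_surjective _, ?_, ?_⟩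
  · rw [← LinearMap.ker_eq_bot, Submodule.ker_liftQ_eq_bot]
    intro φ hφ
    exact hd φ hφ
  · rw [LinearMap.exact_iff, Submodule.ker_mkQ, Submodule.range_liftQ]
  · intro Φ
    obtain ⟨q, hq⟩ := exists_eq_bidualEval (Φ.comp (Submodule.mkQ _))
    have hq' : ∀ φ : Q₁ →ₗ[A] A, op (φ q) = Φ (Submodule.Quotient.mk φ) := LinearMap.congr_fun hq
    have hdq : d q = 0 := eq_zero_of_forall_functional fun ψ => op_injective <| by
      have := hq' (functionalsMap d ψ)
      rw [(Submodule.Quotient.mk_eq_zero _).2 (LinearMap.mem_range_self _ ψ), map_zero] at this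
      exact this
    obtain ⟨y, rfl⟩ := (hex q).1 hdq
    refine ⟨bidualEval A Q₂ y, LinearMap.ext fun z => ?_⟩
    obtain ⟨φ, rfl⟩ := Submodule.mkQ_surjective _ z
    exact hq' φ

lemma isGP_coker_functionalsMap (d : Q₁ →ₗ[A] Q₀) (h : IsGP A (Q₀ ⧸ LinearMap.range d)) :
    IsGP Aᵐᵒᵖ ((Q₁ →ₗ[A] A) ⧸ LinearMap.range (functionalsMap d)) := by
  have hC : IsGPClass Aᵐᵒᵖ (fun X => ∃ (Q₁ Q₀ : ModuleCat.{u} A) (_ : Module.Finite A Q₁)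
      (_ : Module.Projective A Q₁) (_ : Module.Finite A Q₀) (_ : Module.Projective A Q₀)
      (d : Q₁ →ₗ[A] Q₀), IsGP A (Q₀ ⧸ LinearMap.range d) ∧
      Nonempty (X ≃ₗ[Aᵐᵒᵖ] (Q₁ →ₗ[A] A) ⧸ LinearMap.range (functionalsMap d))) := by
    rintro X ⟨Q₁, Q₀, _, _, _, _, d, hGP, ⟨e⟩⟩
    have hrange := hGP.syzygy (LinearMap.range d).subtype (LinearMap.range d).mkQ
      Subtype.val_injective (Submodule.mkQ_surjective _) (LinearMap.exact_subtype_mkQ _)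
    constructor
    · have hker := (hrange.1.syzygy (LinearMap.ker d).subtype d.rangeRestrict
        Subtype.val_injective (LinearMap.surjective_rangeRestrict _) (by
          rw [LinearMap.exact_iff, LinearMap.ker_rangeRestrict, Submodule.range_subtype])).1
      obtain ⟨-, -, -, -, Q₂, _, _, _, _, -, q, -, hq, -⟩ := hker.exists_left
      let d₂ : Q₂ →ₗ[A] Q₁ := (LinearMap.ker d).subtype.comp q
      have hrd₂ : LinearMap.range d₂ = LinearMap.ker d := by
        rw [LinearMap.range_comp, LinearMap.range_eq_top.2 hq, Submodule.map_top,
          Submodule.range_subtype]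
      refine ⟨ModuleCat.of Aᵐᵒᵖ ((Q₂ →ₗ[A] A) ⧸ LinearMap.range (functionalsMap d₂)),
        ⟨ModuleCat.of A Q₂, Q₁, ‹_›, ‹_›, ‹_›, ‹_›, d₂, ?_, ⟨LinearEquiv.refl _ _⟩⟩,
        (approxSES_coker_functionalsMap d₂ d (LinearMap.exact_iff.2 hrd₂.symm) ?_).congr e
          (LinearEquiv.refl _ _)⟩
      · exact isGP_congr (d.quotKerEquivRange.symm.trans
          (Submodule.quotEquivOfEq _ _ hrd₂.symm)) hrange.1
      · intro φ hφ
        obtain ⟨φ', hφ'⟩ := exists_comp_eq_of_ker_le d.surjective_rangeRestrict φ (fun x hx => by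
          obtain ⟨y, rfl⟩ : x ∈ LinearMap.range d₂ := by
            rw [hrd₂]; exact congrArg Subtype.val hx
          exact LinearMap.congr_fun hφ y)
        obtain ⟨ψ, hψ⟩ := hrange.2 φ'
        exact ⟨ψ, by rw [← hφ', ← hψ]; rfl⟩
    · obtain ⟨Y, _, _, hY, P, _, _, _, _, j, q, hj, hq, hex, hd⟩ := hGP.exists_right
      let d' : Q₀ →ₗ[A] P := j.comp (LinearMap.range d).mkQ
      have hker : LinearMap.ker d' = LinearMap.range d := by
        rw [LinearMap.ker_comp, LinearMap.ker_eq_bot.2 hj, ← LinearMap.ker, Submodule.ker_mkQ]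
      have hrange : LinearMap.ker q = LinearMap.range d' := by
        rw [LinearMap.exact_iff.1 hex, LinearMap.range_comp, Submodule.range_mkQ,
          Submodule.map_top]
      refine ⟨ModuleCat.of Aᵐᵒᵖ ((Q₀ →ₗ[A] A) ⧸ LinearMap.range (functionalsMap d')),
        ⟨Q₀, ModuleCat.of A P, ‹_›, ‹_›, ‹_›, ‹_›, d', ?_, ⟨LinearEquiv.refl _ _⟩⟩,
        (approxSES_coker_functionalsMap d d' (LinearMap.exact_iff.2 hker) ?_).congr
          (LinearEquiv.refl _ _) e.symm⟩
      · exact isGP_congr ((q.quotKerEquivOfSurjective hq).symm.trans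
          (Submodule.quotEquivOfEq _ _ hrange)) hY
      · intro φ hφ
        obtain ⟨φ', hφ'⟩ := exists_comp_eq_of_ker_le (Submodule.mkQ_surjective (LinearMap.range d))
          φ (fun x hx => by
            obtain ⟨y, rfl⟩ := (Submodule.Quotient.mk_eq_zero _).1 hx
            exact LinearMap.congr_fun hφ y)
        obtain ⟨ψ, hψ⟩ := hd φ'
        exact ⟨ψ, by rw [← hφ', ← hψ]; rfl⟩
  exact hC.isGP (ModuleCat.of Aᵐᵒᵖ _) ⟨ModuleCat.of A Q₁, ModuleCat.of A Q₀, ‹_›, ‹_›, ‹_›, ‹_›,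
    d, h, ⟨LinearEquiv.refl _ _⟩⟩

/-- The cokernel of a map between finitely generated projective modules is Gorenstein
projective if and only if the cokernel of its transpose is. -/
lemma isGP_coker_functionalsMap_iff (d : Q₁ →ₗ[A] Q₀) :
    IsGP Aᵐᵒᵖ ((Q₁ →ₗ[A] A) ⧸ LinearMap.range (functionalsMap d)) ↔
      IsGP A (Q₀ ⧸ LinearMap.range d) := by
  refine ⟨fun h => ?_, isGP_coker_functionalsMap d⟩
  have h2 := isGP_coker_functionalsMap (functionalsMap d) h
  set Y := ((Q₀ →ₗ[A] A) →ₗ[Aᵐᵒᵖ] Aᵐᵒᵖ) ⧸ LinearMap.range (functionalsMap (functionalsMap d))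
  let _ : Module A Y := Module.compHom Y (RingEquiv.opOp A).toRingHom
  have hY : IsGP A Y := h2.of_ringEquiv (RingEquiv.opOp A) fun _ _ => rfl
  let g : Q₀ →ₗ[A] Y :=
    { toFun := fun q => Submodule.Quotient.mk (bidualEval A Q₀ q)
      map_add' := fun x y => by
        rw [← Submodule.Quotient.mk_add]
        congr 1
        exact LinearMap.ext fun φ => unop_injective (map_add φ x y)
      map_smul' := fun a x => by
        change _ = Submodule.Quotient.mk (op (op a) • bidualEval A Q₀ x)
        congr 1
        exact LinearMap.ext fun φ => unop_injective (map_smul φ a x) }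
  have hg : Surjective g := by
    intro y
    obtain ⟨Φ, rfl⟩ := Submodule.mkQ_surjective _ y
    obtain ⟨q, rfl⟩ := exists_eq_bidualEval Φ
    exact ⟨q, rfl⟩
  have hker : LinearMap.ker g = LinearMap.range d := by
    ext q
    refine (Submodule.Quotient.mk_eq_zero _).trans ⟨?_, ?_⟩
    · rintro ⟨Φ, hΦ⟩
      obtain ⟨p, rfl⟩ := exists_eq_bidualEval Φ
      refine ⟨p, ?_⟩
      rw [← sub_eq_zero]
      refine eq_zero_of_forall_functional (A := A) fun φ => ?_
      have : op (φ (d p)) = op (φ q) := LinearMap.congr_fun hΦ φ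
      rw [map_sub, op_injective this, sub_self]
    · rintro ⟨p, rfl⟩
      exact ⟨bidualEval A Q₁ p, rfl⟩
  exact isGP_congr ((g.quotKerEquivOfSurjective hg).symm.trans
    (Submodule.quotEquivOfEq _ _ hker)) hY

end Transpose

section TorsionPair

variable {A : Type u} [Ring A] {T F : ModuleCat.{u} A → Prop}

lemma IsTorsionPair.hom_eq_zero (h : IsTorsionPair A T F) {X Y : Type u} [AddCommGroup X]
    [Module A X] [AddCommGroup Y] [Module A Y] (hX : T (ModuleCat.of A X))
    (hY : F (ModuleCat.of A Y)) (f : X →ₗ[A] Y) : f = 0 :=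
  h.2.2.2.2.1 (ModuleCat.of A X) (ModuleCat.of A Y) hX hY f

lemma IsTorsionPair.torsion_congr (h : IsTorsionPair A T F) {X Y : Type u} [AddCommGroup X]
    [Module A X] [AddCommGroup Y] [Module A Y] (hX : T (ModuleCat.of A X)) (e : X ≃ₗ[A] Y) :
    T (ModuleCat.of A Y) :=
  h.1 (ModuleCat.of A X) (ModuleCat.of A Y) ⟨e⟩ hX

lemma IsTorsionPair.finite (h : IsTorsionPair A T F) {X : Type u} [AddCommGroup X]
    [Module A X] (hX : T (ModuleCat.of A X)) : Module.Finite A X :=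
  h.2.2.1 _ hX

lemma IsTorsionPair.mem_torsion (h : IsTorsionPair A T F) (X : Type u) [AddCommGroup X]
    [Module A X] [Module.Finite A X]
    (hX : ∀ Y : ModuleCat.{u} A, F Y → ∀ f : X →ₗ[A] Y, f = 0) : T (ModuleCat.of A X) := by
  obtain ⟨t, ht, hF⟩ := h.2.2.2.2.2 (ModuleCat.of A X) ‹_›
  have ht' : t = ⊤ := by
    rw [← Submodule.ker_mkQ t, hX _ hF t.mkQ, LinearMap.ker_zero]
  subst ht'
  exact h.torsion_congr ht Submodule.topEquiv

lemma IsTorsionPair.torsion_of_surjective (h : IsTorsionPair A T F) {X Y : Type u}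
    [AddCommGroup X] [Module A X] [AddCommGroup Y] [Module A Y] (hX : T (ModuleCat.of A X))
    (f : X →ₗ[A] Y) (hf : Surjective f) : T (ModuleCat.of A Y) := by
  have := h.finite hX
  have := Module.Finite.of_surjective f hf
  refine h.mem_torsion Y fun Z hZ g => LinearMap.ext fun y => ?_
  obtain ⟨x, rfl⟩ := hf y
  exact LinearMap.congr_fun (h.hom_eq_zero hX hZ (g.comp f)) x

lemma IsTorsionPair.torsion_of_exact (h : IsTorsionPair A T F) {X Y E : Type u}
    [AddCommGroup X] [Module A X] [AddCommGroup Y] [Module A Y] [AddCommGroup E] [Module A E]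
    [Module.Finite A E] (hX : T (ModuleCat.of A X)) (hY : T (ModuleCat.of A Y))
    {i : X →ₗ[A] E} {p : E →ₗ[A] Y} (hp : Surjective p) (hex : Exact i p) :
    T (ModuleCat.of A E) := by
  refine h.mem_torsion E fun Z hZ g => ?_
  obtain ⟨φ, rfl⟩ := exists_comp_eq_of_ker_le hp g fun x hx => by
    obtain ⟨y, rfl⟩ := (hex x).1 hx
    exact LinearMap.congr_fun (h.hom_eq_zero hX hZ (g.comp i)) y
  rw [h.hom_eq_zero hY hZ φ, LinearMap.zero_comp]

lemma IsTorsionPair.torsion_pi (h : IsTorsionPair A T F) {ι : Type} [Fintype ι]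
    (X : ι → ModuleCat.{u} A) (hX : ∀ i, T (X i)) : T (ModuleCat.of A (∀ i, X i)) := by
  classical
  have := fun i => h.finite (hX i)
  exact h.mem_torsion _ fun Z hZ g => LinearMap.pi_ext' fun i => by
    rw [h.hom_eq_zero (hX i) hZ (g.comp _), LinearMap.zero_comp]

lemma IsTorsionPair.torsion_prod (h : IsTorsionPair A T F) {X Y : Type u}
    [AddCommGroup X] [Module A X] [AddCommGroup Y] [Module A Y] (hX : T (ModuleCat.of A X))
    (hY : T (ModuleCat.of A Y)) : T (ModuleCat.of A (X × Y)) := by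
  have := h.finite hX
  have := h.finite hY
  exact h.torsion_of_exact hX hY (i := LinearMap.inl A X Y) (p := LinearMap.snd A X Y)
    LinearMap.snd_surjective .inl_snd

lemma IsTorsionPair.torsion_pi_const (h : IsTorsionPair A T F) {X : Type u}
    [AddCommGroup X] [Module A X] (hX : T (ModuleCat.of A X)) (n : ℕ) :
    T (ModuleCat.of A (Fin n → X)) :=
  h.torsion_pi (fun _ : Fin n => ModuleCat.of A X) fun _ => hX

lemma IsTorsionPair.contravariantlyFinite (h : IsTorsionPair A T F) :
    ContravariantlyFinite A T := by
  intro X hX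
  obtain ⟨t, ht, hF⟩ := h.2.2.2.2.2 X hX
  refine ⟨_, t.subtype, ht, fun Y g hY => ⟨g.codRestrict t fun y => ?_, rfl⟩⟩
  rw [← Submodule.Quotient.mk_eq_zero]
  exact LinearMap.congr_fun (h.hom_eq_zero hY hF (t.mkQ.comp g)) y

/-- `M` is Ext-projective with respect to `T`. -/
def IsExtProj (T : ModuleCat.{u} A → Prop) (M : Type u) [AddCommGroup M] [Module A M] : Prop :=
  ∀ X : ModuleCat.{u} A, T X → Ext1Vanishes A M X

lemma IsExtProj.exists_lift {M : Type u} [AddCommGroup M] [Module A M] (h : IsExtProj T M)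
    {X Y : Type u} [AddCommGroup X] [Module A X] [AddCommGroup Y] [Module A Y]
    {q : X →ₗ[A] Y} (hq : Surjective q) (hker : T (ModuleCat.of A (LinearMap.ker q)))
    (g : M →ₗ[A] Y) : ∃ φ : M →ₗ[A] X, q.comp φ = g := by
  let E := LinearMap.ker (q.coprod (-g))
  have hE : ∀ x m, (x, m) ∈ E ↔ q x = g m := fun x m => by
    simp [E, ← sub_eq_add_neg, sub_eq_zero]
  let i : LinearMap.ker q →ₗ[A] E :=
    ((LinearMap.inl A X M).comp (LinearMap.ker q).subtype).codRestrict E fun x => by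
      rw [LinearMap.comp_apply, LinearMap.inl_apply, hE, map_zero]; exact x.2
  obtain ⟨s, hs⟩ := h _ hker E i ((LinearMap.snd A X M).comp E.subtype)
    (fun x y hxy => Subtype.ext (congrArg (fun z : E => z.1.1) hxy))
    (fun m => by
      obtain ⟨x, hx⟩ := hq (g m)
      exact ⟨⟨(x, m), (hE x m).2 hx⟩, rfl⟩)
    (by
      rintro ⟨⟨x, m⟩, hxm⟩
      constructor
      · rintro (rfl : m = 0)
        exact ⟨⟨x, ((hE _ _).1 hxm).trans (map_zero g)⟩, rfl⟩
      · rintro ⟨y, hy⟩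
        exact congrArg (fun z : E => z.1.2) hy.symm)
  refine ⟨(LinearMap.fst A X M).comp (E.subtype.comp s), LinearMap.ext fun m => ?_⟩
  have h1 := (hE (s m).1.1 (s m).1.2).1 (s m).2
  have h2 : (s m).1.2 = m := LinearMap.congr_fun hs m
  rw [h2] at h1
  exact h1

lemma isExtProj_of_exists_lift (hT : RespectsIso A T) {M : Type u} [AddCommGroup M] [Module A M]
    (h : ∀ (E : Type u) [AddCommGroup E] [Module A E] (p : E →ₗ[A] M), Surjective p →
      T (ModuleCat.of A (LinearMap.ker p)) → ∃ s : M →ₗ[A] E, p.comp s = LinearMap.id) :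
    IsExtProj T M := by
  intro X hX E _ _ i p hi hp hex
  refine h E p hp (hT X _ ⟨?_⟩ hX)
  exact (LinearEquiv.ofInjective i hi).trans (LinearEquiv.ofEq _ _ hex.linearMap_ker_eq.symm)

lemma IsExtProj.of_retract (hT : RespectsIso A T) {M N : Type u} [AddCommGroup M] [Module A M]
    [AddCommGroup N] [Module A N] (h : IsExtProj T M) (i : N →ₗ[A] M) (p : M →ₗ[A] N)
    (hpi : p.comp i = LinearMap.id) : IsExtProj T N := by
  refine isExtProj_of_exists_lift hT fun E _ _ q hq hker => ?_
  obtain ⟨φ, hφ⟩ := h.exists_lift hq hker p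
  exact ⟨φ.comp i, by rw [← LinearMap.comp_assoc, hφ, hpi]⟩

lemma isExtProj_pi (hT : RespectsIso A T) {ι : Type} [Fintype ι] (X : ι → ModuleCat.{u} A)
    (h : ∀ i, IsExtProj T (X i)) : IsExtProj T (∀ i, X i) := by
  classical
  refine isExtProj_of_exists_lift hT fun E _ _ q hq hker => ?_
  choose s hs using fun i => (h i).exists_lift hq hker (LinearMap.single A (fun i => X i) i)
  refine ⟨LinearMap.lsum A (fun i => X i) ℕ s, LinearMap.pi_ext' fun i => LinearMap.ext fun x => ?_⟩
  change q (LinearMap.lsum A (fun i => X i) ℕ s (Pi.single i x)) = Pi.single i x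
  rw [LinearMap.lsum_piSingle]
  exact LinearMap.congr_fun (hs i) x

lemma IsExtProj.prod (hT : RespectsIso A T) {M N : Type u} [AddCommGroup M] [Module A M]
    [AddCommGroup N] [Module A N] (hM : IsExtProj T M) (hN : IsExtProj T N) :
    IsExtProj T (M × N) := by
  refine isExtProj_of_exists_lift hT fun E _ _ q hq hker => ?_
  obtain ⟨s, hs⟩ := hM.exists_lift hq hker (LinearMap.inl A M N)
  obtain ⟨t, ht⟩ := hN.exists_lift hq hker (LinearMap.inr A M N)
  exact ⟨s.coprod t, by rw [LinearMap.comp_coprod, hs, ht, LinearMap.coprod_inl_inr]⟩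

/-- Every element of a module in `T` is the image of `m` under a map from `M`, that is, `m`
defines a left `T`-approximation of the regular module. -/
def IsApprox (T : ModuleCat.{u} A → Prop) {M : Type u} [AddCommGroup M] [Module A M] (m : M) :
    Prop :=
  ∀ X : ModuleCat.{u} A, T X → ∀ x : X, ∃ h : M →ₗ[A] X, h m = x

variable {M : Type u} [AddCommGroup M] [Module A M] {m : M}

lemma IsApprox.facOf (hm : IsApprox T m) {X : Type u} [AddCommGroup X] [Module A X]
    [Module.Finite A X] (hX : T (ModuleCat.of A X)) : FacOf A M X := by
  obtain ⟨n, x, hx⟩ := Module.Finite.exists_fin (R := A) (M := X)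
  choose h hh using fun i => hm (ModuleCat.of A X) hX (x i)
  refine ⟨n, LinearMap.lsum A (fun _ => M) ℕ h, ?_⟩
  rw [← LinearMap.range_eq_top, ← top_le_iff, ← hx, Submodule.span_le]
  rintro _ ⟨i, rfl⟩
  refine ⟨Pi.single i m, ?_⟩
  rw [LinearMap.lsum_piSingle]
  exact hh i

lemma IsApprox.covariantlyFinite (htp : IsTorsionPair A T F) (hM : T (ModuleCat.of A M))
    (hm : IsApprox T m) : CovariantlyFinite A T := by
  intro X hX
  obtain ⟨n, p, hp⟩ := Module.Finite.exists_fin' A X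
  let f : (Fin n → A) →ₗ[A] (Fin n → M) :=
    LinearMap.pi fun i => (LinearMap.toSpanSingleton A M m).comp (LinearMap.proj i)
  let N := (LinearMap.ker p).map f
  obtain ⟨g, hg⟩ := exists_comp_eq_of_ker_le hp (N.mkQ.comp f) fun x hx =>
    (Submodule.Quotient.mk_eq_zero _).2 (Submodule.mem_map_of_mem hx)
  refine ⟨ModuleCat.of A ((Fin n → M) ⧸ N), g,
    htp.torsion_of_surjective (htp.torsion_pi_const hM n) N.mkQ N.mkQ_surjective, fun Y k hY => ?_⟩
  choose h hh using fun i => hm Y hY (k (p (Pi.single i 1)))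
  let h' : (Fin n → M) →ₗ[A] Y := LinearMap.lsum A (fun _ => M) ℕ h
  have hh' : h'.comp f = k.comp p := LinearMap.pi_ext' fun i => LinearMap.ext_ring <| by
    have : f (Pi.single i 1) = Pi.single i m := by
      ext j
      rcases eq_or_ne j i with rfl | hj <;> simp [f, *]
    change h' (f (Pi.single i 1)) = k (p (Pi.single i 1))
    rw [this, LinearMap.lsum_piSingle, hh]
  obtain ⟨l, hl⟩ := exists_comp_eq_of_ker_le N.mkQ_surjective h' fun x hx => by
    obtain ⟨y, hy, rfl⟩ := (Submodule.Quotient.mk_eq_zero _).1 hx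
    have := LinearMap.congr_fun hh' y
    rw [LinearMap.comp_apply, LinearMap.comp_apply, LinearMap.mem_ker.1 hy, map_zero] at this
    exact this
  refine ⟨l, LinearMap.ext fun x => ?_⟩
  obtain ⟨y, rfl⟩ := hp x
  have h1 : g (p y) = N.mkQ (f y) := LinearMap.congr_fun hg y
  have h2 : l (N.mkQ (f y)) = h' (f y) := LinearMap.congr_fun hl _
  rw [LinearMap.comp_apply, h1, h2]
  exact LinearMap.congr_fun hh' y

lemma IsApprox.isExtProj_quotient (hT : RespectsIso A T) (hM : IsExtProj T M)
    (hm : IsApprox T m) : IsExtProj T (M ⧸ Submodule.span A {m}) := by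
  refine isExtProj_of_exists_lift hT fun E _ _ p hp hker => ?_
  obtain ⟨v, hv⟩ := hM.exists_lift hp hker (Submodule.mkQ _)
  have hv' : ∀ x, p (v x) = Submodule.Quotient.mk x := LinearMap.congr_fun hv
  have hvm : p (v m) = 0 := by
    rw [hv', Submodule.Quotient.mk_eq_zero]
    exact Submodule.mem_span_singleton_self m
  obtain ⟨w, hw⟩ := hm _ hker ⟨v m, hvm⟩
  obtain ⟨s, hs⟩ := exists_comp_eq_of_ker_le (Submodule.mkQ_surjective (Submodule.span A {m}))
    (v - (LinearMap.ker p).subtype.comp w) fun x hx => by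
      obtain ⟨a, rfl⟩ := Submodule.mem_span_singleton.1 ((Submodule.Quotient.mk_eq_zero _).1 hx)
      simp [hw]
  refine ⟨s, LinearMap.ext fun y => ?_⟩
  obtain ⟨x, rfl⟩ := Submodule.mkQ_surjective _ y
  have : s (Submodule.mkQ _ x) = v x - w x := LinearMap.congr_fun hs x
  rw [LinearMap.comp_apply, this, map_sub, LinearMap.mem_ker.1 (w x).2, sub_zero, hv']
  rfl

lemma exists_right_add_approx (K : Type u) [Field K] [Algebra K A] [FiniteDimensional K A]
    (M X : Type u) [AddCommGroup M] [Module A M] [Module.Finite A M] [AddCommGroup X]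
    [Module A X] [Module.Finite A X] :
    ∃ (k : ℕ) (g : (Fin k → M) →ₗ[A] X), ∀ u : M →ₗ[A] X, ∃ v : M →ₗ[A] (Fin k → M),
      g.comp v = u := by
  let _ : Module K M := Module.compHom M (algebraMap K A)
  let _ : Module K X := Module.compHom X (algebraMap K A)
  have : IsScalarTower K A M := .of_algebraMap_smul fun _ _ => rfl
  have : IsScalarTower K A X := .of_algebraMap_smul fun _ _ => rfl
  have : Module.Finite K M := Module.Finite.trans A M
  have : Module.Finite K X := Module.Finite.trans A X
  have : Module.Finite K (M →ₗ[A] X) :=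
    Module.Finite.of_injective (LinearMap.restrictScalarsₗ K A M X K)
      (LinearMap.restrictScalars_injective K)
  obtain ⟨k, s, hs⟩ := Module.Finite.exists_fin (R := K) (M := M →ₗ[A] X)
  refine ⟨k, LinearMap.lsum A (fun _ => M) ℕ s, fun u => ?_⟩
  have hu : u ∈ Submodule.span K (Set.range s) := hs ▸ Submodule.mem_top
  obtain ⟨c, rfl⟩ := (Submodule.mem_span_range_iff_exists_fun K).1 hu
  refine ⟨LinearMap.pi fun i => c i • LinearMap.id, LinearMap.ext fun x => ?_⟩
  simp [LinearMap.lsum_apply, LinearMap.sum_apply, LinearMap.map_smul_of_tower]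

lemma IsApprox.inAdd (K : Type u) [Field K] [Algebra K A] [FiniteDimensional K A]
    (htp : IsTorsionPair A T F) (hMT : T (ModuleCat.of A M)) (hm : IsApprox T m)
    {X : Type u} [AddCommGroup X] [Module A X]
    (hXT : T (ModuleCat.of A X)) (hX : IsExtProj T X) :
    InAdd A (M × (M ⧸ Submodule.span A {m})) X := by
  have hM₁T : T (ModuleCat.of A (M ⧸ Submodule.span A {m})) :=
    htp.torsion_of_surjective hMT (Submodule.mkQ _) (Submodule.mkQ_surjective _)
  have hNT := htp.torsion_prod hMT hM₁T
  have := htp.finite hXT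
  have := htp.finite hMT
  have := htp.finite hNT
  obtain ⟨k, g, hg⟩ := exists_right_add_approx (A := A) K (M × (M ⧸ Submodule.span A {m})) X
  have hgs : Surjective g := by
    intro x
    obtain ⟨h, hh⟩ := hm _ hXT x
    obtain ⟨v, hv⟩ := hg (h.comp (LinearMap.fst A _ _))
    exact ⟨v (m, 0), (LinearMap.congr_fun hv (m, 0)).trans hh⟩
  have hkT : T (ModuleCat.of A (LinearMap.ker g)) := by
    have key : ∀ n : LinearMap.ker g, ∃ w : M →ₗ[A] LinearMap.ker g, w m = n := by
      intro n
      obtain ⟨u, hu⟩ := hm _ (htp.torsion_pi_const hNT k) n.1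
      obtain ⟨φ, hφ⟩ := exists_comp_eq_of_ker_le (Submodule.mkQ_surjective (Submodule.span A {m}))
        (g.comp u) fun x hx => by
          obtain ⟨a, rfl⟩ :=
            Submodule.mem_span_singleton.1 ((Submodule.Quotient.mk_eq_zero _).1 hx)
          rw [map_smul, LinearMap.comp_apply, hu, LinearMap.mem_ker.1 n.2, smul_zero]
      obtain ⟨v, hv⟩ := hg (φ.comp (LinearMap.snd A _ _))
      let w : M →ₗ[A] _ :=
        (v.comp (LinearMap.inr A _ _)).comp (Submodule.mkQ (Submodule.span A {m}))
      have hw : ∀ x, g (w x) = g (u x) := fun x =>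
        (LinearMap.congr_fun hv (0, Submodule.mkQ _ x)).trans (LinearMap.congr_fun hφ x)
      have hwm : w m = 0 := by
        have : Submodule.mkQ (Submodule.span A {m}) m = 0 :=
          (Submodule.Quotient.mk_eq_zero _).2 (Submodule.mem_span_singleton_self m)
        change v (0, Submodule.mkQ _ m) = 0
        rw [this]
        exact map_zero v
      refine ⟨(u - w).codRestrict _ fun x => by simp [hw], Subtype.ext ?_⟩
      change u m - w m = n
      rw [hwm, sub_zero, hu]
    have : IsNoetherian K A := inferInstance
    have : IsNoetherianRing A := isNoetherian_of_tower K ‹_›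
    obtain ⟨n, x, hx⟩ := Module.Finite.exists_fin (R := A) (M := LinearMap.ker g)
    choose h hh using fun i => key (x i)
    refine htp.torsion_of_surjective (htp.torsion_pi_const hMT n)
      (LinearMap.lsum A (fun _ => M) ℕ h) ?_
    rw [← LinearMap.range_eq_top, ← top_le_iff, ← hx, Submodule.span_le]
    rintro _ ⟨i, rfl⟩
    refine ⟨Pi.single i m, ?_⟩
    rw [LinearMap.lsum_piSingle]
    exact hh i
  obtain ⟨s, hs⟩ := hX.exists_lift hgs hkT LinearMap.id
  exact ⟨k, s, g, hs⟩

end TorsionPair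

section BasicGenerator

variable {A : Type u} [Ring A]

lemma inAdd_of_fintype {G X : Type u} [AddCommGroup G] [Module A G] [AddCommGroup X] [Module A X]
    {ι : Type} [Fintype ι] (i : X →ₗ[A] (ι → G)) (p : (ι → G) →ₗ[A] X)
    (hpi : p.comp i = LinearMap.id) : InAdd A G X := by
  let e := LinearEquiv.funCongrLeft A G (Fintype.equivFin ι).symm
  exact ⟨Fintype.card ι, e.toLinearMap.comp i, p.comp e.symm.toLinearMap,
    LinearMap.ext fun x => by simpa using LinearMap.congr_fun hpi x⟩

lemma InAdd.trans {G H X : Type u} [AddCommGroup G] [Module A G] [AddCommGroup H] [Module A H]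
    [AddCommGroup X] [Module A X] (hX : InAdd A H X) (hH : InAdd A G H) : InAdd A G X := by
  obtain ⟨n, i, p, hpi⟩ := hX
  obtain ⟨m, j, q, hqj⟩ := hH
  let e := LinearEquiv.curry A G (Fin n) (Fin m)
  refine inAdd_of_fintype (ι := Fin n × Fin m)
    (e.symm.toLinearMap.comp ((LinearMap.pi fun k => j.comp (LinearMap.proj k)).comp i))
    (p.comp ((LinearMap.pi fun k => q.comp (LinearMap.proj k)).comp e.toLinearMap))
    (LinearMap.ext fun x => ?_)
  have : ∀ y : Fin n → H, (fun k => q (j (y k))) = y := fun y =>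
    funext fun k => LinearMap.congr_fun hqj (y k)
  have h2 : e (e.symm fun k => j (i x k)) = fun k => j (i x k) := e.apply_symm_apply _
  change p (fun k => q (e (e.symm fun k => j (i x k)) k)) = x
  rw [h2, this]
  exact LinearMap.congr_fun hpi x

lemma InAdd.facOf {G X Y : Type u} [AddCommGroup G] [Module A G] [AddCommGroup X]
    [Module A X] [AddCommGroup Y] [Module A Y] (h : InAdd A G X) (hY : FacOf A X Y) :
    FacOf A G Y := by
  obtain ⟨n, p, hp⟩ := hY
  have : InAdd A G (Fin n → X) := InAdd.trans ⟨n, LinearMap.id, LinearMap.id, rfl⟩ h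
  obtain ⟨m, i, q, hqi⟩ := this
  exact ⟨m, p.comp q, hp.comp fun x => ⟨i x, LinearMap.congr_fun hqi x⟩⟩

lemma IsIndec.congr {M N : Type u} [AddCommGroup M] [Module A M] [AddCommGroup N] [Module A N]
    (e : M ≃ₗ[A] N) (h : IsIndec A M) : IsIndec A N := by
  have := h.1
  refine ⟨e.symm.toEquiv.nontrivial, fun N₁ N₂ hN => ?_⟩
  have := h.2 (Submodule.orderIsoMapComap e.symm N₁) (Submodule.orderIsoMapComap e.symm N₂)
    ((Submodule.orderIsoMapComap e.symm).isCompl hN)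
  simpa using this

lemma exists_indec_decomposition (M : Type u) [AddCommGroup M] [Module A M] [IsArtinian A M] :
    ∃ (n : ℕ) (V : Fin n → ModuleCat.{u} A), (∀ i, IsIndec A (V i)) ∧
      Nonempty (M ≃ₗ[A] ∀ i, V i) := by
  have key : ∀ N : Submodule A M, ∃ (ι : Type) (_ : Fintype ι) (V : ι → ModuleCat.{u} A),
      (∀ i, IsIndec A (V i)) ∧ Nonempty (N ≃ₗ[A] ∀ i, V i) := by
    intro N
    induction N using WellFoundedLT.induction with
    | ind N ih =>
      rcases subsingleton_or_nontrivial N with hN | hN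
      · exact ⟨Empty, inferInstance, fun _ => ModuleCat.of A PUnit, nofun,
          ⟨LinearEquiv.ofSubsingleton _ _⟩⟩
      by_cases hind : IsIndec A N
      · exact ⟨Unit, inferInstance, fun _ => ModuleCat.of A N, fun _ => hind,
          ⟨(LinearEquiv.funUnique Unit A N).symm⟩⟩
      · obtain ⟨N₁, N₂, hc, h1, h2⟩ : ∃ N₁ N₂ : Submodule A N, IsCompl N₁ N₂ ∧ N₁ ≠ ⊥ ∧ N₂ ≠ ⊥ := by
          by_contra! hcon
          exact hind ⟨hN, fun N₁ N₂ hc => or_iff_not_imp_left.2 fun h1 => hcon N₁ N₂ hc h1⟩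
        have hlt : ∀ L : Submodule A N, L ≠ ⊤ → L.map N.subtype < N := fun L hL =>
          (Submodule.map_subtype_le N L).lt_of_ne fun h => hL <|
            Submodule.map_injective_of_injective N.injective_subtype <| by
              rw [h, Submodule.map_top, Submodule.range_subtype]
        obtain ⟨ι₁, _, V₁, hV₁, ⟨e₁⟩⟩ := ih _ (hlt N₁ fun h => h2 <| by
          simpa [h] using hc.inf_eq_bot)
        obtain ⟨ι₂, _, V₂, hV₂, ⟨e₂⟩⟩ := ih _ (hlt N₂ fun h => h1 <| by
          simpa [h] using hc.inf_eq_bot)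
        let V : ι₁ ⊕ ι₂ → ModuleCat.{u} A := Sum.elim V₁ V₂
        refine ⟨ι₁ ⊕ ι₂, inferInstance, V, ?_, ⟨?_⟩⟩
        · rintro (i | i)
          · exact hV₁ i
          · exact hV₂ i
        · exact (Submodule.prodEquivOfIsCompl N₁ N₂ hc).symm.trans
            ((((Submodule.equivMapOfInjective _ N.injective_subtype N₁).trans e₁).prodCongr
              ((Submodule.equivMapOfInjective _ N.injective_subtype N₂).trans e₂)).trans
              (LinearEquiv.sumPiEquivProdPi A ι₁ ι₂ fun i => V i).symm)
  obtain ⟨ι, _, V, hV, ⟨e⟩⟩ := key ⊤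
  exact ⟨Fintype.card ι, fun k => V ((Fintype.equivFin ι).symm k), fun k => hV _,
    ⟨(Submodule.topEquiv.symm.trans e).trans
      (LinearEquiv.piCongrLeft A (fun i => V i) (Fintype.equivFin ι).symm).symm⟩⟩

lemma isBasic_pi {n : ℕ} (V : Fin n → ModuleCat.{u} A) (hV : ∀ i, IsIndec A (V i))
    (hne : ∀ i j, i ≠ j → ¬ Nonempty (V i ≃ₗ[A] V j)) : IsBasic A (∀ i, V i) := by
  have e : ∀ i, V i ≃ₗ[A] LinearMap.range (LinearMap.single A (fun i => V i) i) := fun i =>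
    LinearEquiv.ofInjective _ (LinearMap.ker_eq_bot.1 (LinearMap.ker_single A _ i))
  refine ⟨n, fun i => LinearMap.range (LinearMap.single A (fun i => V i) i), ?_,
    fun i => (hV i).congr (e i), fun i j hij ⟨f⟩ =>
      hne i j hij ⟨(e i).trans (f.trans (e j).symm)⟩⟩
  rw [DirectSum.isInternal_submodule_iff_iSupIndep_and_iSup_eq_top]
  refine ⟨fun i => ?_, LinearMap.iSup_range_single A _⟩
  simpa using LinearMap.disjoint_single_single A (fun i => V i) {i} {i}ᶜ disjoint_compl_right

lemma inAdd_pi_of_equiv {n : ℕ} (V : Fin (n + 1) → ModuleCat.{u} A) (i j : Fin (n + 1))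
    (hij : i ≠ j) (e : V i ≃ₗ[A] V j) : InAdd A (∀ k, V (j.succAbove k)) (∀ k, V k) := by
  obtain ⟨i, rfl⟩ := Fin.exists_succAbove_eq hij
  let r : (∀ k, V k) →ₗ[A] ∀ k, V (j.succAbove k) := LinearMap.pi fun k => LinearMap.proj _
  let s : (∀ k, V k) →ₗ[A] ∀ k, V (j.succAbove k) :=
    (LinearMap.single A (fun k => V (j.succAbove k)) i).comp
      (e.symm.toLinearMap.comp (LinearMap.proj j))
  let p : (Fin 2 → ∀ k, V (j.succAbove k)) →ₗ[A] ∀ k, V k := LinearMap.pi <| j.succAboveCases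
    (e.toLinearMap.comp ((LinearMap.proj (φ := fun k => V (j.succAbove k)) i).comp
      (LinearMap.proj 1)))
    fun k => (LinearMap.proj (φ := fun k => V (j.succAbove k)) k).comp (LinearMap.proj 0)
  refine ⟨2, LinearMap.pi ![r, s], p, LinearMap.ext fun x => funext fun k => ?_⟩
  rcases eq_or_ne k j with rfl | hk
  · simp [p, s]
  · obtain ⟨k, rfl⟩ := Fin.exists_succAbove_eq hk
    simp [p, r]

variable {T F : ModuleCat.{u} A → Prop} {M : Type u} [AddCommGroup M] [Module A M] {m : M}

lemma exists_isBasicExtProjGen (K : Type u) [Field K] [Algebra K A] [FiniteDimensional K A]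
    (htp : IsTorsionPair A T F) (hMT : T (ModuleCat.of A M)) (hm : IsApprox T m)
    (hM : IsExtProj T M) : ∃ G, IsBasicExtProjGen A T G := by
  let P : ℕ → Prop := fun n => ∃ V : Fin n → ModuleCat.{u} A, (∀ i, IsIndec A (V i)) ∧
    (∀ i, T (V i) ∧ IsExtProj T (V i)) ∧
    ∀ X : ModuleCat.{u} A, T X → IsExtProj T X → InAdd A (∀ i, V i) X
  have hP : ∃ n, P n := by
    let G := M × (M ⧸ Submodule.span A {m})
    have hGT : T (ModuleCat.of A G) := htp.torsion_prod hMT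
      (htp.torsion_of_surjective hMT (Submodule.mkQ _) (Submodule.mkQ_surjective _))
    have hG : IsExtProj T G := hM.prod htp.1 (hm.isExtProj_quotient htp.1 hM)
    have := htp.finite hGT
    have : IsArtinian K A := inferInstance
    have : IsArtinianRing A := isArtinian_of_tower K ‹_›
    obtain ⟨n, V, hV, ⟨e⟩⟩ := exists_indec_decomposition (A := A) G
    refine ⟨n, V, hV, fun i => ⟨?_, ?_⟩, fun X hX hX' => ?_⟩
    · exact htp.torsion_of_surjective hGT
        ((LinearMap.proj (φ := fun i => V i) i).comp e.toLinearMap)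
        ((LinearMap.proj_surjective (R := A) (φ := fun i => V i) i).comp e.surjective)
    · exact hG.of_retract htp.1 (e.symm.toLinearMap.comp (LinearMap.single A (fun i => V i) i))
        ((LinearMap.proj i).comp e.toLinearMap) (LinearMap.ext fun x => by simp)
    · refine (hm.inAdd K htp hMT hX hX').trans (H := G) ?_
      exact inAdd_of_fintype (ι := Unit) (LinearMap.pi fun _ => e.toLinearMap)
        (e.symm.toLinearMap.comp (LinearMap.proj ())) (LinearMap.ext fun x => by simp)
  classical
  obtain ⟨n, ⟨V, hV, hVT, hVX⟩, hmin⟩ : ∃ n, P n ∧ ∀ k < n, ¬ P k :=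
    ⟨Nat.find hP, Nat.find_spec hP, fun _ => Nat.find_min hP⟩
  have hG : InAdd A (∀ i, V i) M := hVX (ModuleCat.of A M) hMT hM
  have hGT : T (ModuleCat.of A (∀ i, V i)) := htp.torsion_pi V fun i => (hVT i).1
  refine ⟨ModuleCat.of A (∀ i, V i), hGT, isBasic_pi V hV fun i j hij ⟨e⟩ => ?_,
    isExtProj_pi htp.1 V fun i => (hVT i).2, fun X => ⟨fun hX => ?_, ?_⟩, hVX⟩
  · obtain _ | n := n
    · exact i.elim0
    exact hmin n (Nat.lt_succ_self n) ⟨fun k => V (j.succAbove k), fun k => hV _,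
      fun k => hVT _, fun X hX hX' => (hVX X hX hX').trans (inAdd_pi_of_equiv V i j hij e)⟩
  · have := htp.finite (X := X) hX
    exact ⟨this, hG.facOf (hm.facOf (X := X) hX)⟩
  · rintro ⟨-, k, p, hp⟩
    exact htp.torsion_of_surjective (htp.torsion_pi_const hGT k) p hp

lemma forall_isBasicExtProjGen_isGP_iff (K : Type u) [Field K] [Algebra K A]
    [FiniteDimensional K A] (htp : IsTorsionPair A T F) (hMT : T (ModuleCat.of A M))
    (hm : IsApprox T m) (hM : IsExtProj T M) :
    (∀ G, IsBasicExtProjGen A T G → IsGP A G) ↔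
      IsGP A M ∧ IsGP A (M ⧸ Submodule.span A {m}) := by
  constructor
  · intro h
    obtain ⟨G, hG⟩ := exists_isBasicExtProjGen K htp hMT hm hM
    exact ⟨(h G hG).of_inAdd (hG.2.2.2.2 (ModuleCat.of A M) hMT hM),
      (h G hG).of_inAdd (hG.2.2.2.2 (ModuleCat.of A _)
        (htp.torsion_of_surjective hMT (Submodule.mkQ _) (Submodule.mkQ_surjective _))
        (hm.isExtProj_quotient htp.1 hM))⟩
  · rintro ⟨h1, h2⟩ G hG
    exact (h1.prod h2).of_inAdd (hm.inAdd K htp hMT (X := G) hG.1 hG.2.2.1)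

end BasicGenerator

section Presentation

variable {A : Type u} [Ring A] {T F : ModuleCat.{u} A → Prop}

lemma exists_isExtProj_isApprox [IsNoetherianRing A] [IsArtinianRing A]
    (htp : IsTorsionPair A T F) (hcov : CovariantlyFinite A T) :
    ∃ (M : Type u) (_ : AddCommGroup M) (_ : Module A M) (m : M),
      T (ModuleCat.of A M) ∧ IsApprox T m ∧ IsExtProj T M := by
  obtain ⟨M, f, hMT, hf⟩ := hcov (ModuleCat.of A A) (inferInstanceAs (Module.Finite A A))
  have hfin := htp.finite (X := M) hMT
  let S : Set (Submodule A M) := {N | f (1 : A) ∈ N ∧ T (ModuleCat.of A N)}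
  have hS : S.Nonempty := ⟨⊤, Submodule.mem_top,
    htp.torsion_congr (X := M) hMT Submodule.topEquiv.symm⟩
  obtain ⟨N, ⟨hfN, hNT⟩, hmin⟩ := wellFounded_lt.has_min S hS
  have happ : IsApprox T (⟨f (1 : A), hfN⟩ : N) := by
    intro X hX x
    obtain ⟨h, hh⟩ := hf X (LinearMap.toSpanSingleton A X x) hX
    refine ⟨h.comp N.subtype, ?_⟩
    have := LinearMap.congr_fun hh (1 : A)
    simpa using this
  refine ⟨N, _, _, ⟨f (1 : A), hfN⟩, hNT, happ,
    isExtProj_of_exists_lift htp.1 fun E _ _ p hp hker => ?_⟩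
  have := htp.finite hker
  have hquot : Module.Finite A (E ⧸ LinearMap.ker p) :=
    .equiv (p.quotKerEquivOfSurjective hp).symm
  have hE : Module.Finite A E := .of_submodule_quotient (LinearMap.ker p)
  have hET : T (ModuleCat.of A E) :=
    htp.torsion_of_exact hker hNT hp (LinearMap.exact_subtype_ker_map p)
  obtain ⟨e, he⟩ := hp ⟨f (1 : A), hfN⟩
  obtain ⟨h, hh⟩ := happ _ hET e
  let φ : N →ₗ[A] N := p.comp h
  have hφ : φ ⟨f (1 : A), hfN⟩ = ⟨f (1 : A), hfN⟩ := by
    change p (h _) = _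
    rw [hh, he]
  have hφs : Surjective φ := by
    have hle : LinearMap.range (N.subtype.comp φ) ≤ N := by
      rintro _ ⟨x, rfl⟩
      exact (φ x).2
    have hmem : LinearMap.range (N.subtype.comp φ) ∈ S :=
      ⟨⟨_, congrArg Subtype.val hφ⟩, htp.torsion_of_surjective hNT
        (N.subtype.comp φ).rangeRestrict (LinearMap.surjective_rangeRestrict _)⟩
    have heq := hle.eq_of_not_lt (hmin _ hmem)
    intro x
    obtain ⟨y, hy⟩ : (x : M) ∈ LinearMap.range (N.subtype.comp φ) := heq.ge x.2
    exact ⟨y, Subtype.ext hy⟩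
  have hφi : Injective φ := IsNoetherian.injective_of_surjective_endomorphism φ hφs
  let ψ := LinearEquiv.ofBijective φ ⟨hφi, hφs⟩
  exact ⟨h.comp ψ.symm.toLinearMap, LinearMap.ext fun x => ψ.apply_symm_apply x⟩

lemma exists_projective_cover [IsNoetherianRing A] [IsArtinianRing A] (L : Type u)
    [AddCommGroup L] [Module A L] [Module.Finite A L] :
    ∃ (Q : Type u) (_ : AddCommGroup Q) (_ : Module A Q) (p : Q →ₗ[A] L), Module.Finite A Q ∧
      Module.Projective A Q ∧ Surjective p ∧ IsSuperfluous A (LinearMap.ker p) := by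
  obtain ⟨n, p, hp⟩ := Module.Finite.exists_fin' A L
  let S : Set (Submodule A (Fin n → A)) :=
    {Q | Module.Projective A Q ∧ Surjective (p.comp Q.subtype)}
  have hS : S.Nonempty := ⟨⊤, .of_equiv Submodule.topEquiv.symm,
    hp.comp Submodule.topEquiv.surjective⟩
  obtain ⟨Q, ⟨hQ, hpQ⟩, hmin⟩ := wellFounded_lt.has_min S hS
  refine ⟨Q, _, _, p.comp Q.subtype, inferInstance, hQ, hpQ, fun N hN => ?_⟩
  have hpN : Surjective ((p.comp Q.subtype).comp N.subtype) := by
    intro x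
    obtain ⟨q, rfl⟩ := hpQ x
    obtain ⟨k, hk, y, hy, rfl⟩ := Submodule.mem_sup.1 (hN ▸ Submodule.mem_top : q ∈ _ ⊔ N)
    exact ⟨⟨y, hy⟩, by rw [map_add, LinearMap.mem_ker.1 hk, zero_add]; rfl⟩
  obtain ⟨φ', hφ'⟩ := Module.projective_lifting_property _ (p.comp Q.subtype) hpN
  let φ : Module.End A Q := N.subtype.comp φ'
  have hφ : ∀ x, p (φ x) = p x := LinearMap.congr_fun hφ'
  obtain ⟨k, hk0, hk⟩ := ((Filter.eventually_ge_atTop 1).and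
    φ.eventually_isCompl_ker_pow_range_pow).exists
  have hφk : ∀ j x, p ((φ ^ j) x) = p x := by
    intro j
    induction j with
    | zero => intro x; rfl
    | succ j ih => intro x; rw [pow_succ', Module.End.mul_apply, hφ, ih]
  have hproj : Module.Projective A (LinearMap.range (φ ^ k)) :=
    Module.Projective.of_split (LinearMap.range (φ ^ k)).subtype
      (Submodule.projectionOnto _ _ hk.symm)
      (LinearMap.ext fun x => Submodule.projectionOnto_apply_left _ x)
  have hmem : (LinearMap.range (φ ^ k)).map Q.subtype ∈ S := by
    refine ⟨.of_equiv (Submodule.equivMapOfInjective _ Q.injective_subtype _), fun x => ?_⟩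
    obtain ⟨q, rfl⟩ := hpQ x
    exact ⟨⟨_, Submodule.mem_map_of_mem (LinearMap.mem_range_self _ q)⟩, hφk k q⟩
  have heq := (Submodule.map_subtype_le Q _).eq_of_not_lt (hmin _ hmem)
  rw [eq_top_iff]
  intro x _
  obtain ⟨-, ⟨y, rfl⟩, hy⟩ : (x : Fin n → A) ∈ (LinearMap.range (φ ^ k)).map Q.subtype :=
    heq.ge x.2
  obtain ⟨k, rfl⟩ : ∃ j, k = j + 1 := ⟨k - 1, by omega⟩
  rw [← Subtype.ext hy, pow_succ', Module.End.mul_apply]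
  exact (φ' _).2

lemma IsExtProj.exists_comp_eq (htp : IsTorsionPair A T F) {Q₁ Q₀ M X : Type u}
    [AddCommGroup Q₁] [Module A Q₁] [AddCommGroup Q₀] [Module A Q₀] [Module.Projective A Q₀]
    [AddCommGroup M] [Module A M] [AddCommGroup X] [Module A X] (hM : IsExtProj T M)
    {d : Q₁ →ₗ[A] Q₀} {π : Q₀ →ₗ[A] M} (hπ : Surjective π) (hex : Exact d π)
    (hd : IsSuperfluous A (LinearMap.ker d)) (hX : T (ModuleCat.of A X)) (a : Q₁ →ₗ[A] X) :
    ∃ c : Q₀ →ₗ[A] X, c.comp d = a := by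
  let N := (LinearMap.ker d).map a
  have hX' : T (ModuleCat.of A (X ⧸ N)) := htp.torsion_of_surjective hX N.mkQ N.mkQ_surjective
  let b : Q₁ →ₗ[A] X ⧸ N := N.mkQ.comp a
  have hb : ∀ q, d q = 0 → b q = 0 := fun q hq =>
    (Submodule.Quotient.mk_eq_zero _).2 (Submodule.mem_map_of_mem hq)
  let L := LinearMap.range (b.prod (-d))
  let i : X ⧸ N →ₗ[A] (((X ⧸ N) × Q₀) ⧸ L) := L.mkQ.comp (LinearMap.inl A _ _)
  obtain ⟨p, hp⟩ := exists_comp_eq_of_ker_le L.mkQ_surjective (π.comp (LinearMap.snd A _ _))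
    fun x hx => by
      obtain ⟨q, rfl⟩ := (Submodule.Quotient.mk_eq_zero _).1 hx
      simp [hex.apply_apply_eq_zero]
  have hp' : ∀ x y, p (L.mkQ (x, y)) = π y := fun x y => LinearMap.congr_fun hp (x, y)
  have hL : ∀ q, L.mkQ (0, d q) = i (b q) := fun q => by
    rw [← sub_eq_zero, ← neg_eq_zero]
    change -(L.mkQ (0, d q) - L.mkQ (b q, 0)) = 0
    rw [← map_sub, ← map_neg]
    exact (Submodule.Quotient.mk_eq_zero _).2 ⟨q, by simp⟩
  have hi : Injective i := by
    rw [injective_iff_map_eq_zero]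
    intro x hx
    obtain ⟨q, hq⟩ := (Submodule.Quotient.mk_eq_zero _).1 hx
    have h1 : b q = x := congrArg Prod.fst hq
    have h2 : -d q = 0 := congrArg Prod.snd hq
    rw [← h1, hb q (neg_eq_zero.1 h2)]
  obtain ⟨s, hs⟩ := hM _ hX' _ i p hi
    (fun y => by
      obtain ⟨q, rfl⟩ := hπ y
      exact ⟨L.mkQ (0, q), hp' _ _⟩)
    (fun z => by
      obtain ⟨⟨x, y⟩, rfl⟩ := L.mkQ_surjective z
      rw [hp']
      constructor
      · intro hy
        obtain ⟨q, rfl⟩ := (hex y).1 hy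
        refine ⟨x + b q, ?_⟩
        have : ((x, d q) : (X ⧸ N) × Q₀) = (x, 0) + (0, d q) := by simp
        rw [this, map_add, map_add, hL]
        rfl
      · rintro ⟨x', hx'⟩
        rw [← hp' x y, ← hx']
        exact (hp' x' 0).trans (map_zero π))
  have hs' : ∀ z, p (s z) = z := LinearMap.congr_fun hs
  have hpi : ∀ x, p (i x) = 0 := fun x => (hp' x 0).trans (map_zero π)
  obtain ⟨c₀, hc₀⟩ := exists_comp_eq_of_injective hi
    ((LinearMap.id - s.comp p).comp (L.mkQ.comp (LinearMap.inr A (X ⧸ N) Q₀))) fun y => by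
      have hz : p (L.mkQ (0, y) - s (p (L.mkQ (0, y)))) = 0 := by rw [map_sub, hs', sub_self]
      obtain ⟨⟨x, y'⟩, hxy⟩ := L.mkQ_surjective (L.mkQ (0, y) - s (p (L.mkQ (0, y))))
      rw [← hxy, hp'] at hz
      obtain ⟨q, rfl⟩ := (hex y').1 hz
      refine ⟨x + b q, ?_⟩
      change _ = L.mkQ (0, y) - s (p (L.mkQ (0, y)))
      have : ((x, d q) : (X ⧸ N) × Q₀) = (x, 0) + (0, d q) := by simp
      rw [← hxy, this, map_add, map_add, hL]
      rfl
  have hc₀d : ∀ q, c₀ (d q) = b q := fun q => hi <| by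
    have : i (c₀ (d q)) = L.mkQ (0, d q) - s (p (L.mkQ (0, d q))) := LinearMap.congr_fun hc₀ (d q)
    rw [this, hL, hpi, map_zero, sub_zero]
  obtain ⟨c, hc⟩ := Module.projective_lifting_property N.mkQ c₀ N.mkQ_surjective
  refine ⟨c, ?_⟩
  have hker : LinearMap.ker (c.comp d - a) = ⊤ := hd _ <| by
    rw [eq_top_iff]
    intro q _
    have hq : N.mkQ (a q - c (d q)) = 0 := by
      have : N.mkQ (c (d q)) = c₀ (d q) := LinearMap.congr_fun hc (d q)
      rw [map_sub, this, hc₀d]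
      exact sub_self _
    obtain ⟨k, hk, hkq⟩ := (Submodule.Quotient.mk_eq_zero _).1 hq
    refine Submodule.mem_sup.2 ⟨k, hk, q - k, ?_, by abel⟩
    change c (d (q - k)) - a (q - k) = 0
    simp [map_sub, LinearMap.mem_ker.1 hk, hkq]
  rw [← sub_eq_zero, ← LinearMap.ker_eq_top, hker]

end Presentation

section Duality

variable {K R : Type u} [Field K] [Ring R] [Algebra K R]

/-- The class of the modules isomorphic to `D Y` for some `Y` in the class `F`. -/
def DualClass (K R : Type u) [Field K] [Ring R] [Algebra K R] (F : ModuleCat.{u} R → Prop) :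
    ModuleCat.{u} Rᵐᵒᵖ → Prop :=
  fun X => ∃ (Y : Type u) (_ : AddCommGroup Y) (_ : Module R Y)
    (_ : Module K Y) (_ : IsScalarTower K R Y),
    F (ModuleCat.of R Y) ∧ Nonempty (X ≃ₗ[Rᵐᵒᵖ] LDual R K Y)

lemma respectsIso_dualClass (F : ModuleCat.{u} R → Prop) :
    RespectsIso Rᵐᵒᵖ (DualClass K R F) := by
  rintro X Z ⟨e⟩ ⟨Y, _, _, _, _, hY, ⟨f⟩⟩
  exact ⟨Y, _, _, _, _, hY, ⟨e.symm.trans f⟩⟩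

/-- Every module over a `K`-algebra is compatibly a vector space over `K`. -/
lemma exists_module_isScalarTower (K A : Type u) [Field K] [Ring A] [Algebra K A] (X : Type u)
    [AddCommGroup X] [Module A X] : ∃ _ : Module K X, IsScalarTower K A X :=
  letI : Module K X := Module.compHom X (algebraMap K A)
  ⟨this, .of_algebraMap_smul fun _ _ => rfl⟩

instance opposite_finite [FiniteDimensional K R] : FiniteDimensional K Rᵐᵒᵖ :=
  .equiv (MulOpposite.opLinearEquiv K)

lemma exists_dual_eval_eq {Y : Type u} [AddCommGroup Y] [Module K Y] [Module.Finite K Y]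
    (φ : (Y →ₗ[K] K) →ₗ[K] K) : ∃ y, ∀ n, φ n = n y :=
  ⟨(Module.evalEquiv K Y).symm φ, fun n =>
    (LinearMap.congr_fun ((Module.evalEquiv K Y).apply_symm_apply φ) n).symm⟩

lemma lDual_finite [FiniteDimensional K R] {Y : Type u} [AddCommGroup Y] [Module R Y] [Module K Y]
    [IsScalarTower K R Y] [Module.Finite R Y] : Module.Finite Rᵐᵒᵖ (LDual R K Y) := by
  have : Module.Finite K Y := .trans R Y
  have : Module.Finite K (LDual R K Y) := inferInstanceAs (Module.Finite K (Y →ₗ[K] K))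
  exact .of_restrictScalars_finite K Rᵐᵒᵖ _

lemma eq_zero_of_lDual_hom [FiniteDimensional K R] {Y Z : Type u} [AddCommGroup Y] [Module R Y]
    [Module K Y] [IsScalarTower K R Y] [AddCommGroup Z] [Module R Z] [Module K Z]
    [IsScalarTower K R Z] [Module.Finite R Y] (h : ∀ g : Z →ₗ[R] Y, g = 0)
    (f : LDual R K Y →ₗ[Rᵐᵒᵖ] LDual R K Z) : f = 0 := by
  have : Module.Finite K Y := .trans R Y
  have hf : ∀ z : Z, ∃ y : Y, ∀ n, LDual.toL R K Z (f n) z = LDual.toL R K Y n y := fun z =>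
    exists_dual_eval_eq (Y := Y)
      { toFun := fun n => LDual.toL R K Z (f n) z
        map_add' := fun a b =>
          LinearMap.congr_fun (congrArg (LDual.toL R K Z) (f.map_add a b)) z
        map_smul' := fun k a => LinearMap.congr_fun
          (congrArg (LDual.toL R K Z) ((f.restrictScalars K).map_smul k a)) z }
  choose g hg using hf
  have hsep : ∀ y y' : Y, (∀ n : LDual R K Y, LDual.toL R K Y n y = LDual.toL R K Y n y') →
      y = y' := fun y y' hy =>
    sub_eq_zero.1 <| (Module.forall_dual_apply_eq_zero_iff K _).1 fun n => by
      rw [map_sub]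
      exact sub_eq_zero.2 (hy n)
  let g' : Z →ₗ[R] Y :=
    { toFun := g
      map_add' := fun z z' => hsep _ _ fun n => by
        rw [← hg, map_add, map_add, hg, hg]
      map_smul' := fun r z => hsep _ _ fun n => by
        have h1 := hg z (op r • n)
        rw [map_smul, LDual.smul_toL, LDual.smul_toL] at h1
        rw [← hg]
        exact h1 }
  refine LinearMap.ext fun n => LDual.toL_injective R K Z <| LinearMap.ext fun z => ?_
  rw [hg, show g z = 0 from LinearMap.congr_fun (h g') z, map_zero]
  rfl

/-- Evaluation of the functionals in a submodule of `D X`. -/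
def evalOn {X : Type u} [AddCommGroup X] [Module Rᵐᵒᵖ X] [Module K X] [IsScalarTower K Rᵐᵒᵖ X]
    (t : Submodule R (OpDual R K X)) : X →ₗ[Rᵐᵒᵖ] LDual R K t where
  toFun x :=
    ({ toFun := fun φ => OpDual.toL R K X φ.1 x
       map_add' := fun _ _ => rfl
       map_smul' := fun _ _ => rfl } : t →ₗ[K] K)
  map_add' x y := LDual.toL_injective R K t <| LinearMap.ext fun φ =>
    map_add (OpDual.toL R K X φ.1) x y
  map_smul' _ _ := rfl

lemma evalOn_apply {X : Type u} [AddCommGroup X] [Module Rᵐᵒᵖ X] [Module K X]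
    [IsScalarTower K Rᵐᵒᵖ X] (t : Submodule R (OpDual R K X)) (x : X) (φ : t) :
    LDual.toL R K t (evalOn t x) φ = OpDual.toL R K X φ.1 x := rfl

/-- Evaluation at the common kernel of the functionals in `t`. -/
def evalQuot {X : Type u} [AddCommGroup X] [Module Rᵐᵒᵖ X] [Module K X] [IsScalarTower K Rᵐᵒᵖ X]
    (t : Submodule R (OpDual R K X)) :
    LinearMap.ker (evalOn t) →ₗ[Rᵐᵒᵖ] LDual R K (OpDual R K X ⧸ t) where
  toFun x :=
    ((t.restrictScalars K).liftQ
      ({ toFun := fun φ => OpDual.toL R K X φ x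
         map_add' := fun _ _ => rfl
         map_smul' := fun _ _ => rfl } : OpDual R K X →ₗ[K] K)
      (fun φ hφ => LinearMap.congr_fun (congrArg (LDual.toL R K t) x.2) ⟨φ, hφ⟩) :)
  map_add' x y := LDual.toL_injective R K (OpDual R K X ⧸ t) <| LinearMap.ext fun φ => by
    obtain ⟨φ, rfl⟩ := t.mkQ_surjective φ
    exact map_add (OpDual.toL R K X φ) (x : X) y
  map_smul' _ x := LDual.toL_injective R K (OpDual R K X ⧸ t) <| LinearMap.ext fun φ => by
    obtain ⟨φ, rfl⟩ := t.mkQ_surjective φ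
    rfl

lemma evalOn_surjective {X : Type u} [AddCommGroup X] [Module Rᵐᵒᵖ X] [Module K X]
    [IsScalarTower K Rᵐᵒᵖ X] [Module.Finite K X] (t : Submodule R (OpDual R K X)) :
    Surjective (evalOn t) := by
  intro f
  obtain ⟨g, hg⟩ := (LDual.toL R K t f).exists_extend (p := t.restrictScalars K)
  obtain ⟨x, hx⟩ := exists_dual_eval_eq (Y := X) g
  refine ⟨x, LDual.toL_injective R K _ <| LinearMap.ext fun φ => ?_⟩
  rw [evalOn_apply]
  exact (hx _).symm.trans (LinearMap.congr_fun hg φ)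

lemma evalQuot_bijective {X : Type u} [AddCommGroup X] [Module Rᵐᵒᵖ X] [Module K X]
    [IsScalarTower K Rᵐᵒᵖ X] [Module.Finite K X] (t : Submodule R (OpDual R K X)) :
    Bijective (evalQuot t) := by
  constructor
  · rw [injective_iff_map_eq_zero]
    intro x hx
    refine Subtype.ext <| (Module.forall_dual_apply_eq_zero_iff K _).1 fun φ => ?_
    exact LinearMap.congr_fun (congrArg (LDual.toL R K _) hx) (t.mkQ φ)
  · intro f
    obtain ⟨x, hx⟩ := exists_dual_eval_eq (Y := X)
      ((LDual.toL R K _ f).comp (t.mkQ.restrictScalars K))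
    have hx0 : evalOn t x = 0 := LDual.toL_injective R K _ <| LinearMap.ext fun φ => by
      rw [evalOn_apply]
      refine (hx φ.1).symm.trans ?_
      change LDual.toL R K _ f (t.mkQ φ.1) = 0
      rw [show t.mkQ φ.1 = 0 from (Submodule.Quotient.mk_eq_zero _).2 φ.2, map_zero]
    refine ⟨⟨x, hx0⟩, LDual.toL_injective R K _ <| LinearMap.ext fun φ => ?_⟩
    obtain ⟨φ, rfl⟩ := t.mkQ_surjective φ
    exact (hx φ).symm

lemma IsTorsionPair.dualClass [FiniteDimensional K R] {T F : ModuleCat.{u} R → Prop}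
    (h : IsTorsionPair R T F) : IsTorsionPair Rᵐᵒᵖ (DualClass K R F) (DualClass K R T) := by
  have hfin : ∀ Y : ModuleCat.{u} R, T Y ∨ F Y → Module.Finite R Y := by
    rintro Y (hY | hY)
    exacts [h.2.2.1 Y hY, h.2.2.2.1 Y hY]
  refine ⟨respectsIso_dualClass F, respectsIso_dualClass T, ?_, ?_, ?_, ?_⟩
  · rintro X ⟨Y, _, _, _, _, hY, ⟨e⟩⟩
    have : Module.Finite R Y := hfin (.of R Y) (.inr hY)
    have : Module.Finite Rᵐᵒᵖ (LDual R K Y) := lDual_finite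
    exact .equiv e.symm
  · rintro X ⟨Y, _, _, _, _, hY, ⟨e⟩⟩
    have : Module.Finite R Y := hfin (.of R Y) (.inl hY)
    have : Module.Finite Rᵐᵒᵖ (LDual R K Y) := lDual_finite
    exact .equiv e.symm
  · rintro X X' ⟨Y, _, _, _, _, hY, ⟨e⟩⟩ ⟨Z, _, _, _, _, hZ, ⟨e'⟩⟩ f
    have : Module.Finite R Y := hfin (.of R Y) (.inr hY)
    have h0 := eq_zero_of_lDual_hom (fun g => h.hom_eq_zero hZ hY g)
      (e'.toLinearMap.comp (f.comp e.symm.toLinearMap))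
    refine LinearMap.ext fun x => e'.injective ?_
    have := LinearMap.congr_fun h0 (e x)
    simpa using this
  · intro X hX
    obtain ⟨_, _⟩ := exists_module_isScalarTower K Rᵐᵒᵖ X
    have : Module.Finite K X := .trans Rᵐᵒᵖ X
    have : Module.Finite K (OpDual R K X) := inferInstanceAs (Module.Finite K (X →ₗ[K] K))
    obtain ⟨t, htT, htF⟩ := h.2.2.2.2.2 (ModuleCat.of R (OpDual R K X))
      (.of_restrictScalars_finite K R (OpDual R K X))
    exact ⟨LinearMap.ker (evalOn t), ⟨_, _, _, _, _, htF, ⟨.ofBijective _ (evalQuot_bijective t)⟩⟩,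
      ⟨_, _, _, _, _, htT, ⟨(evalOn t).quotKerEquivOfSurjective (evalOn_surjective t)⟩⟩⟩

end Duality

section Cokernel

variable {A : Type u} [Ring A]

lemma isExtProj_coker {T : ModuleCat.{u} A → Prop} (hT : RespectsIso A T) {B C : Type u}
    [AddCommGroup B] [Module A B] [AddCommGroup C] [Module A C] [Module.Projective A B]
    (u : C →ₗ[A] B)
    (h : ∀ N : ModuleCat.{u} A, T N → ∀ v : C →ₗ[A] N, ∃ w : B →ₗ[A] N, w.comp u = v) :
    IsExtProj T (B ⧸ LinearMap.range u) := by
  refine isExtProj_of_exists_lift hT fun E _ _ p hp hker => ?_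
  obtain ⟨g, hg⟩ := Module.projective_lifting_property p (LinearMap.range u).mkQ hp
  have hgu : ∀ c, g (u c) ∈ LinearMap.ker p := fun c => by
    rw [LinearMap.mem_ker, show p (g (u c)) = _ from LinearMap.congr_fun hg (u c)]
    exact (Submodule.Quotient.mk_eq_zero _).2 ⟨c, rfl⟩
  obtain ⟨w, hw⟩ := h _ hker ((g.comp u).codRestrict _ hgu)
  refine ⟨(LinearMap.range u).liftQ (g - (LinearMap.ker p).subtype.comp w) ?_, ?_⟩
  · rintro _ ⟨c, rfl⟩
    have : w (u c) = ⟨g (u c), hgu c⟩ := LinearMap.congr_fun hw c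
    simp [this]
  · refine Submodule.linearMap_qext _ <| LinearMap.ext fun b => ?_
    have h1 : p (g b) = (LinearMap.range u).mkQ b := LinearMap.congr_fun hg b
    have h2 : p (w b) = 0 := (w b).2
    change p (g b - w b) = (LinearMap.range u).mkQ b
    rw [map_sub, h1, h2, sub_zero]

lemma nonempty_quotient_range_coprod_equiv {Q₁ Q₀ M : Type u} [AddCommGroup Q₁] [Module A Q₁]
    [AddCommGroup Q₀] [Module A Q₀] [AddCommGroup M] [Module A M] {d : Q₁ →ₗ[A] Q₀}
    {π : Q₀ →ₗ[A] M} (hπ : Surjective π) (hex : Exact d π) (q : Q₀) :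
    Nonempty ((Q₀ ⧸ LinearMap.range (d.coprod (LinearMap.toSpanSingleton A Q₀ q))) ≃ₗ[A]
      (M ⧸ Submodule.span A {π q})) := by
  have hker : LinearMap.ker ((Submodule.span A {π q}).mkQ.comp π) =
      LinearMap.range (d.coprod (LinearMap.toSpanSingleton A Q₀ q)) := by
    ext x
    rw [LinearMap.mem_ker, LinearMap.comp_apply, Submodule.mkQ_apply,
      Submodule.Quotient.mk_eq_zero, Submodule.mem_span_singleton]
    constructor
    · rintro ⟨r, hr⟩
      obtain ⟨y, hy⟩ := (hex (x - r • q)).1 (by rw [map_sub, map_smul, hr, sub_self])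
      exact ⟨(y, r), by simp [hy]⟩
    · rintro ⟨⟨y, r⟩, rfl⟩
      exact ⟨r, by simp [hex.apply_apply_eq_zero]⟩
  exact ⟨(Submodule.quotEquivOfEq _ _ hker.symm).trans
    (LinearMap.quotKerEquivOfSurjective _ ((Submodule.mkQ_surjective _).comp hπ))⟩

lemma nonempty_quotient_functionals_equiv {Q₁ Q₀ : Type u} [AddCommGroup Q₁] [Module A Q₁]
    [AddCommGroup Q₀] [Module A Q₀] (d : Q₁ →ₗ[A] Q₀) (q : Q₀) :
    Nonempty ((((Q₁ × A →ₗ[A] A) ⧸ LinearMap.range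
        (functionalsMap (d.coprod (LinearMap.toSpanSingleton A Q₀ q)))) ⧸
          Submodule.span Aᵐᵒᵖ {(LinearMap.range (functionalsMap
            (d.coprod (LinearMap.toSpanSingleton A Q₀ q)))).mkQ (LinearMap.snd A Q₁ A)})
      ≃ₗ[Aᵐᵒᵖ] ((Q₁ →ₗ[A] A) ⧸ LinearMap.range (functionalsMap d))) := by
  set d' := d.coprod (LinearMap.toSpanSingleton A Q₀ q)
  let f : (Q₁ × A →ₗ[A] A) →ₗ[Aᵐᵒᵖ] ((Q₁ →ₗ[A] A) ⧸ LinearMap.range (functionalsMap d)) :=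
    (LinearMap.range (functionalsMap d)).mkQ.comp (functionalsMap (LinearMap.inl A Q₁ A))
  have hf : Surjective f := (Submodule.mkQ_surjective _).comp fun φ =>
    ⟨φ.comp (LinearMap.fst A Q₁ A), LinearMap.ext fun _ => rfl⟩
  have hle : LinearMap.range (functionalsMap d') ≤ LinearMap.ker f := by
    rintro _ ⟨c, rfl⟩
    refine (Submodule.Quotient.mk_eq_zero _).2 ⟨c, LinearMap.ext fun x => ?_⟩
    simp [functionalsMap, d']
  have hg : Surjective ((LinearMap.range (functionalsMap d')).liftQ f hle) := fun y => by
    obtain ⟨x, rfl⟩ := hf y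
    exact ⟨Submodule.Quotient.mk x, rfl⟩
  have hker : LinearMap.ker ((LinearMap.range (functionalsMap d')).liftQ f hle) =
      Submodule.span Aᵐᵒᵖ
        {(LinearMap.range (functionalsMap d')).mkQ (LinearMap.snd A Q₁ A)} := by
    ext x
    obtain ⟨φ, rfl⟩ := Submodule.mkQ_surjective _ x
    rw [LinearMap.mem_ker, Submodule.mem_span_singleton]
    constructor
    · intro h
      obtain ⟨c, hc⟩ := (Submodule.Quotient.mk_eq_zero _).1 h
      have hc' : ∀ x, c (d x) = φ (x, 0) := LinearMap.congr_fun hc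
      refine ⟨op (φ (0, 1) - c q), ?_⟩
      rw [← map_smul, ← sub_eq_zero, ← map_sub]
      refine (Submodule.Quotient.mk_eq_zero _).2 ⟨-c, LinearMap.ext fun y => ?_⟩
      obtain ⟨y, r⟩ := y
      have hφ : φ (y, r) = φ (y, 0) + r * φ (0, 1) := by
        rw [← smul_eq_mul, ← map_smul, ← map_add]
        simp
      change -(c (d y + r • q)) = op (φ (0, 1) - c q) • r - φ (y, r)
      rw [hφ, map_add, hc', map_smul, op_smul_eq_mul, smul_eq_mul, mul_sub]
      abel
    · rintro ⟨r, hr⟩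
      rw [← hr, map_smul]
      have : (LinearMap.range (functionalsMap d')).liftQ f hle
          ((LinearMap.range (functionalsMap d')).mkQ (LinearMap.snd A Q₁ A)) = 0 :=
        (Submodule.Quotient.mk_eq_zero _).2 ⟨0, LinearMap.ext fun x => rfl⟩
      rw [this, smul_zero]
  exact ⟨(Submodule.quotEquivOfEq _ _ hker.symm).trans (LinearMap.quotKerEquivOfSurjective _ hg)⟩

end Cokernel

section HomDuality

variable {K R : Type u} [Field K] [Ring R] [Algebra K R]
variable {P Q Y : Type u} [AddCommGroup P] [Module R P] [AddCommGroup Q] [Module R Q]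
  [AddCommGroup Y] [Module R Y] [Module K Y] [IsScalarTower K R Y]

/-- Precomposition with `d`, as a `K`-linear map. -/
def homMap (K : Type u) [Field K] [Algebra K R] (Y : Type u) [AddCommGroup Y] [Module R Y]
    [Module K Y] [IsScalarTower K R Y] (d : P →ₗ[R] Q) : (Q →ₗ[R] Y) →ₗ[K] (P →ₗ[R] Y) where
  toFun c := c.comp d
  map_add' _ _ := rfl
  map_smul' _ _ := rfl

lemma exists_functional_of_hom [Module.Finite R P] [Module.Projective R P]
    (v : (P →ₗ[R] R) →ₗ[Rᵐᵒᵖ] LDual R K Y) :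
    ∃ l : (P →ₗ[R] Y) →ₗ[K] K, ∀ ψ y, l (ψ.smulRight y) = LDual.toL R K Y (v ψ) y := by
  obtain ⟨n, x, f, hf⟩ := exists_dual_basis (A := R) P
  refine ⟨∑ i, (LDual.toL R K Y (v (f i))).comp
    ({ toFun := fun a => a (x i)
       map_add' := fun _ _ => rfl
       map_smul' := fun _ _ => rfl } : (P →ₗ[R] Y) →ₗ[K] Y), fun ψ y => ?_⟩
  have hadd : ∀ s : Finset (Fin n), LDual.toL R K Y (∑ i ∈ s, v (op (ψ (x i)) • f i)) y =
      ∑ i ∈ s, LDual.toL R K Y (v (f i)) (ψ (x i) • y) := fun s => by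
    induction s using Finset.cons_induction with
    | empty => rfl
    | cons i s hi ih =>
      rw [Finset.sum_cons, Finset.sum_cons, LDual.toL_add, LinearMap.add_apply, ih, map_smul,
        LDual.smul_toL, unop_op]
  conv_rhs => rw [← sum_op_smul_functional hf ψ, map_sum, hadd]
  rw [LinearMap.sum_apply]
  rfl

lemma exists_hom_of_functional (l : (P →ₗ[R] Y) →ₗ[K] K) :
    ∃ v : (P →ₗ[R] R) →ₗ[Rᵐᵒᵖ] LDual R K Y,
      ∀ ψ y, LDual.toL R K Y (v ψ) y = l (ψ.smulRight y) :=
  ⟨{ toFun := fun ψ =>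
      ({ toFun := fun y => l (ψ.smulRight y)
         map_add' := fun y z => by
          rw [← map_add]
          exact congrArg l (LinearMap.ext fun x => smul_add (ψ x) y z)
         map_smul' := fun k y => by
          rw [RingHom.id_apply, ← map_smul]
          exact congrArg l (LinearMap.ext fun x => smul_comm (ψ x) k y) } : Y →ₗ[K] K)
     map_add' := fun φ ψ => LDual.toL_injective R K Y <| LinearMap.ext fun y => by
      change l _ = l _ + l _
      rw [← map_add]
      exact congrArg l (LinearMap.ext fun x => add_smul (φ x) (ψ x) y)
     map_smul' := fun r ψ => LDual.toL_injective R K Y <| LinearMap.ext fun y =>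
      congrArg l (LinearMap.ext fun x => mul_smul (ψ x) (unop r) y) }, fun _ _ => rfl⟩

lemma functional_eq_zero [Module.Finite R P] [Module.Projective R P]
    {l : (P →ₗ[R] Y) →ₗ[K] K} (h : ∀ (ψ : P →ₗ[R] R) (y : Y), l (ψ.smulRight y) = 0) : l = 0 := by
  obtain ⟨n, x, f, hf⟩ := exists_dual_basis (A := R) P
  refine LinearMap.ext fun a => ?_
  have : a = ∑ i, (f i).smulRight (a (x i)) := LinearMap.ext fun p => by
    conv_lhs => rw [← hf p]
    simp [LinearMap.sum_apply]
  rw [this, map_sum]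
  exact Finset.sum_eq_zero fun i _ => h _ _

end HomDuality

section DualPresentation

variable {K R : Type u} [Field K] [Ring R] [Algebra K R] {T F : ModuleCat.{u} R → Prop}
  {P Q : Type u} [AddCommGroup P] [Module R P] [AddCommGroup Q] [Module R Q]

lemma dualClass_coker_functionalsMap [Module.Finite R P] [Module.Projective R P]
    [Module.Finite R Q] [Module.Projective R Q] (htp : IsTorsionPair Rᵐᵒᵖ (DualClass K R F)
    (DualClass K R T)) (d : P →ₗ[R] Q)
    (hd : ∀ X : ModuleCat.{u} R, T X → ∀ a : P →ₗ[R] X, ∃ c : Q →ₗ[R] X, c.comp d = a) :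
    DualClass K R F (ModuleCat.of Rᵐᵒᵖ ((P →ₗ[R] R) ⧸ LinearMap.range (functionalsMap d))) := by
  refine htp.mem_torsion _ ?_
  rintro Z ⟨X, _, _, _, _, hX, ⟨e⟩⟩ f
  let v : (P →ₗ[R] R) →ₗ[Rᵐᵒᵖ] LDual R K X :=
    (e.toLinearMap.comp f).comp (LinearMap.range (functionalsMap d)).mkQ
  have hv : ∀ φ, v (functionalsMap d φ) = 0 := fun φ => by
    have : (LinearMap.range (functionalsMap d)).mkQ (functionalsMap d φ) = 0 :=
      (Submodule.Quotient.mk_eq_zero _).2 ⟨φ, rfl⟩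
    change e (f _) = 0
    rw [this, map_zero, map_zero]
  obtain ⟨l, hl⟩ := exists_functional_of_hom v
  have hld : l.comp (homMap K X d) = 0 := functional_eq_zero fun ψ y => by
    have : homMap K X d (ψ.smulRight y) = (functionalsMap d ψ).smulRight y := rfl
    rw [LinearMap.comp_apply, this, hl, hv]
    rfl
  have hv0 : v = 0 := LinearMap.ext fun ψ => LDual.toL_injective R K X <| LinearMap.ext fun y => by
    obtain ⟨c, hc⟩ := hd (ModuleCat.of R X) hX (ψ.smulRight y)
    rw [← hl, ← hc]
    exact LinearMap.congr_fun hld c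
  refine Submodule.linearMap_qext _ <| LinearMap.ext fun ψ => e.injective ?_
  exact (LinearMap.congr_fun hv0 ψ).trans (map_zero e).symm

lemma isExtProj_coker_functionalsMap [Module.Finite R P] [Module.Projective R P]
    [Module.Finite R Q] [Module.Projective R Q] (d : P →ₗ[R] Q)
    (hd : ∀ Y : ModuleCat.{u} R, F Y → ∀ c : Q →ₗ[R] Y, c.comp d = 0 → c = 0) :
    IsExtProj (DualClass K R F) ((P →ₗ[R] R) ⧸ LinearMap.range (functionalsMap d)) := by
  refine isExtProj_coker (respectsIso_dualClass F) _ ?_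
  rintro N ⟨Y, _, _, _, _, hY, ⟨e⟩⟩ v
  obtain ⟨l, hl⟩ := exists_functional_of_hom (e.toLinearMap.comp v)
  obtain ⟨g, hg⟩ := (homMap K Y d).exists_leftInverse_of_injective <|
    (LinearMap.ker_eq_bot').2 fun c hc => hd (ModuleCat.of R Y) hY c hc
  obtain ⟨w, hw⟩ := exists_hom_of_functional (l.comp g)
  refine ⟨e.symm.toLinearMap.comp w, LinearMap.ext fun ψ => e.injective ?_⟩
  change e (e.symm (w (functionalsMap d ψ))) = e (v ψ)
  rw [e.apply_symm_apply]
  refine LDual.toL_injective R K Y <| LinearMap.ext fun y => ?_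
  have : homMap K Y d (ψ.smulRight y) = (functionalsMap d ψ).smulRight y := rfl
  rw [hw, ← this, LinearMap.comp_apply, ← LinearMap.comp_apply g, hg, LinearMap.id_apply, hl]
  rfl

lemma isApprox_coker_functionalsMap (d : P →ₗ[R] Q) (φ : P →ₗ[R] R)
    (hd : ∀ Y : ModuleCat.{u} R, F Y → ∀ (c : Q →ₗ[R] Y) (y : Y), c.comp d = φ.smulRight y →
      y = 0) :
    IsApprox (DualClass K R F) ((LinearMap.range (functionalsMap d)).mkQ φ) := by
  rintro N ⟨Y, _, _, _, _, hY, ⟨e⟩⟩ n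
  let β : Y →ₗ[K] (P →ₗ[R] Y) ⧸ LinearMap.range (homMap K Y d) :=
    (LinearMap.range (homMap K Y d)).mkQ.comp
      ({ toFun := fun y => φ.smulRight y
         map_add' := fun y z => LinearMap.ext fun x => smul_add (φ x) y z
         map_smul' := fun k y => LinearMap.ext fun x => smul_comm (φ x) k y } :
        Y →ₗ[K] (P →ₗ[R] Y))
  obtain ⟨g, hg⟩ := β.exists_leftInverse_of_injective <| (LinearMap.ker_eq_bot').2 fun y hy => by
    obtain ⟨c, hc⟩ := (Submodule.Quotient.mk_eq_zero _).1 hy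
    exact hd (ModuleCat.of R Y) hY c y hc
  obtain ⟨v, hv⟩ := exists_hom_of_functional
    ((LDual.toL R K Y (e n)).comp (g.comp (LinearMap.range (homMap K Y d)).mkQ))
  refine ⟨(LinearMap.range (functionalsMap d)).liftQ (e.symm.toLinearMap.comp v) ?_, ?_⟩
  · rintro _ ⟨ψ, rfl⟩
    have : v (functionalsMap d ψ) = 0 := LDual.toL_injective R K Y <| LinearMap.ext fun y => by
      have h0 : (LinearMap.range (homMap K Y d)).mkQ ((functionalsMap d ψ).smulRight y) = 0 :=
        (Submodule.Quotient.mk_eq_zero _).2 ⟨ψ.smulRight y, rfl⟩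
      rw [hv, LinearMap.comp_apply, LinearMap.comp_apply, h0, map_zero, map_zero]
      rfl
    rw [LinearMap.mem_ker, LinearMap.comp_apply, this, map_zero]
  · change e.symm (v φ) = n
    rw [LinearEquiv.symm_apply_eq]
    refine LDual.toL_injective R K Y <| LinearMap.ext fun y => ?_
    rw [hv]
    exact congrArg (LDual.toL R K Y (e n)) (LinearMap.congr_fun hg y)

end DualPresentation

/-- A functorially finite torsion pair `(T, F)` in `mod Λ` is
Gorenstein iff `(DF, DT)` is a Gorenstein torsion pair in `mod Λᵒᵖ`, where
`DF = {D F' : F' ∈ F}` and `DT = {D T' : T' ∈ T}`. -/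
theorem gorenstein_torsion_pair_dual (K R : Type u) [Field K] [Ring R]
    [Algebra K R] [FiniteDimensional K R]
    (T F : ModuleCat.{u} R → Prop)
    (htp : IsTorsionPair R T F) (hff : FunctoriallyFinite R T) :
    IsGorensteinTP R T F ↔
      IsGorensteinTP Rᵐᵒᵖ
        (fun X => ∃ (Y : Type u) (_ : AddCommGroup Y) (_ : Module R Y)
          (_ : Module K Y) (_ : IsScalarTower K R Y),
          F (ModuleCat.of R Y) ∧ Nonempty (X ≃ₗ[Rᵐᵒᵖ] LDual R K Y))
        (fun X => ∃ (Y : Type u) (_ : AddCommGroup Y) (_ : Module R Y)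
          (_ : Module K Y) (_ : IsScalarTower K R Y),
          T (ModuleCat.of R Y) ∧ Nonempty (X ≃ₗ[Rᵐᵒᵖ] LDual R K Y)) := by
  change IsGorensteinTP R T F ↔ IsGorensteinTP Rᵐᵒᵖ (DualClass K R F) (DualClass K R T)
  have hnoeth : IsNoetherianRing R := isNoetherian_of_tower K inferInstance
  have hart : IsArtinianRing R := isArtinian_of_tower K inferInstance
  obtain ⟨M, _, _, m, hMT, hm, hM⟩ := exists_isExtProj_isApprox htp hff.1
  have := htp.finite hMT
  obtain ⟨n, π, hπ⟩ := Module.Finite.exists_fin' R M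
  obtain ⟨Q₁, _, _, p, _, _, hp, hsup⟩ := exists_projective_cover (A := R) (LinearMap.ker π)
  let d : Q₁ →ₗ[R] (Fin n → R) := (LinearMap.ker π).subtype.comp p
  have hker : LinearMap.ker d = LinearMap.ker p :=
    LinearMap.ker_comp_of_ker_eq_bot _ (Submodule.ker_subtype _)
  rw [← hker] at hsup
  have hex : Exact d π := fun x => by
    constructor
    · intro hx
      obtain ⟨y, hy⟩ := hp ⟨x, hx⟩
      exact ⟨y, congrArg Subtype.val hy⟩
    · rintro ⟨y, rfl⟩
      exact (p y).2
  obtain ⟨q, rfl⟩ := hπ m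
  let d' : Q₁ × R →ₗ[R] (Fin n → R) := d.coprod (LinearMap.toSpanSingleton R _ q)
  have hd'T : ∀ X : ModuleCat.{u} R, T X → ∀ a : Q₁ × R →ₗ[R] X,
      ∃ c : (Fin n → R) →ₗ[R] X, c.comp d' = a := fun X hX a => by
    obtain ⟨c, hc⟩ := hM.exists_comp_eq htp hπ hex hsup hX (a.comp (LinearMap.inl R Q₁ R))
    obtain ⟨h, hh⟩ := hm X hX (a (0, 1) - c q)
    refine ⟨c + h.comp π, LinearMap.prod_ext ?_ (LinearMap.ext_ring ?_)⟩
    · rw [← hc]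
      exact LinearMap.ext fun x => by simp [d', hex.apply_apply_eq_zero]
    · simp [d', hh]
  have hdF : ∀ Y : ModuleCat.{u} R, F Y → ∀ c : (Fin n → R) →ₗ[R] Y,
      (∀ x, c (d x) = 0) → c = 0 := fun Y hY c hc => by
    obtain ⟨b, rfl⟩ := exists_comp_eq_of_ker_le hπ c fun x hx => by
      obtain ⟨y, rfl⟩ := (hex x).1 hx
      exact hc y
    rw [htp.hom_eq_zero hMT hY b, LinearMap.zero_comp]
  have htp' := htp.dualClass (K := K)
  have hE := dualClass_coker_functionalsMap htp' d' hd'T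
  have hEproj : IsExtProj (DualClass K R F)
      ((Q₁ × R →ₗ[R] R) ⧸ LinearMap.range (functionalsMap d')) :=
    isExtProj_coker_functionalsMap d' fun Y hY c hc => hdF Y hY c fun x => by
      simpa [d'] using LinearMap.congr_fun hc (x, 0)
  have he : IsApprox (DualClass K R F)
      ((LinearMap.range (functionalsMap d')).mkQ (LinearMap.snd R Q₁ R)) :=
    isApprox_coker_functionalsMap d' _ fun Y hY c y hc => by
      have hc0 : c = 0 := hdF Y hY c fun x => by
        simpa [d'] using LinearMap.congr_fun hc (x, 0)
      subst hc0
      simpa using (LinearMap.congr_fun hc (0, 1)).symm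
  obtain ⟨e₁⟩ := nonempty_quotient_range_coprod_equiv hπ hex q
  obtain ⟨e₂⟩ := nonempty_quotient_functionals_equiv d q
  have e₀ : ((Fin n → R) ⧸ LinearMap.range d) ≃ₗ[R] M :=
    (Submodule.quotEquivOfEq _ _ hex.linearMap_ker_eq.symm).trans (π.quotKerEquivOfSurjective hπ)
  have key : (∀ G, IsBasicExtProjGen R T G → IsGP R G) ↔
      ∀ G, IsBasicExtProjGen Rᵐᵒᵖ (DualClass K R F) G → IsGP Rᵐᵒᵖ G := by
    rw [forall_isBasicExtProjGen_isGP_iff K htp hMT hm hM,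
      forall_isBasicExtProjGen_isGP_iff K htp' hE he hEproj,
      isGP_coker_functionalsMap_iff d', and_comm]
    refine and_congr ⟨isGP_congr e₁.symm, isGP_congr e₁⟩ ⟨fun h => ?_, fun h => ?_⟩
    · exact isGP_congr e₂.symm ((isGP_coker_functionalsMap_iff d).2 (isGP_congr e₀.symm h))
    · exact isGP_congr e₀ ((isGP_coker_functionalsMap_iff d).1 (isGP_congr e₂ h))
  constructor
  · intro h
    exact ⟨htp', ⟨he.covariantlyFinite htp' hE, htp'.contravariantlyFinite⟩, key.1 h.2.2⟩
  · intro h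
    exact ⟨htp, hff, key.2 h.2.2⟩

end GPTau
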